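/- arXiv:2012.11491 — 4 statements merged into one kernel-verified Lean document; each statement's English description precedes it below -/
import Mathlib

section
/- Let t0 ≥ 0, m ≥ 1, σ > 0, τ_1,…,τ_m > 0, and let a, b_1,…,b_m, g, h_1,…,h_m : ℝ → ℝ be Lebesgue measurable with 0 ≤ t − g(t) ≤ σ and 0 ≤ t − h_k(t) ≤ τ_k for almost every t ≥ t0. Suppose there exist constants α > 0, A0 ∈ [0,1), B_1,…,B_m ≥ 0, P ≥ 0 and Q_1,…,Q_m ≥ 0 such that for almost every t ≥ t0: b(t) := ∑_{k=1}^m b_k(t) ≥ α, |a(t)| ≤ A0, |b_k(t)| ≤ B_k, |a(t)|/b(t) ≤ P and |b_k(t)|/b(t) ≤ Q_k, and that ((∑_{k=1}^m B_k)/(1 − A0)) · (P + ∑_{k=1}^m τ_k·Q_k) < 1. Then the neutral equation x'(t) − a(t)x'(g(t)) = −∑_{k=1}^m b_k(t)·x(h_k(t)) is uniformly exponentially stable for initial times in [t0,∞). -/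
open MeasureTheory Real

/-- The extended derivative: `deriv x t` for `t ≥ s`, the prescribed initial
derivative `ψ t` for `t < s`. -/
noncomputable def Dfun (x ψ : ℝ → ℝ) (s : ℝ) : ℝ → ℝ :=
  fun t => if s ≤ t then deriv x t else ψ t

/-- A function `f : ℝ → ℝ` is (globally) bounded. -/
def Bdd (f : ℝ → ℝ) : Prop := ∃ C : ℝ, ∀ u : ℝ, |f u| ≤ C

/-- `x` is a solution on `[s,∞)` of the neutral equation
`x'(t) - a(t) x'(g(t)) = -∑ k, b k t * x (h k t)` with initial data `(φ, ψ)`. -/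
def IsNeutralSolution (m : ℕ) (a : ℝ → ℝ) (b : Fin m → ℝ → ℝ) (g : ℝ → ℝ)
    (h : Fin m → ℝ → ℝ) (s : ℝ) (φ ψ x : ℝ → ℝ) : Prop :=
  (∀ t ≤ s, x t = φ t) ∧
  (∀ t, s ≤ t → DifferentiableAt ℝ x t) ∧
  (∀ t1, s ≤ t1 → ∃ C : ℝ, ∀ t ∈ Set.Icc s t1, |deriv x t| ≤ C) ∧
  (∀ᵐ t : ℝ ∂volume, s ≤ t →
    Dfun x ψ s t - a t * Dfun x ψ s (g t) = -∑ k, b k t * x (h k t))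

/-- Uniform exponential stability of the neutral equation
`x'(t) - a(t) x'(g(t)) = -∑ k, b k t * x (h k t)` for initial times in `[t0,∞)`. -/
def UnifExpStable (m : ℕ) (a : ℝ → ℝ) (b : Fin m → ℝ → ℝ) (g : ℝ → ℝ)
    (h : Fin m → ℝ → ℝ) (t0 : ℝ) : Prop :=
  ∃ M > (0:ℝ), ∃ γ > (0:ℝ), ∀ s, t0 ≤ s → ∀ φ ψ x : ℝ → ℝ, Bdd φ → Bdd ψ →
    IsNeutralSolution m a b g h s φ ψ x →
    ∀ t, s ≤ t →
      |x t| ≤ M * Real.exp (-γ * (t - s)) * ⨆ u : {u : ℝ // u ≤ s}, (|φ u.1| + |ψ u.1|)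

section Helpers

open Set Filter Topology

lemma aux_antitone {f : ℝ → ℝ} {p q C : ℝ}
    (hd : ∀ t ∈ Icc p q, DifferentiableAt ℝ f t)
    (hb : ∀ t ∈ Icc p q, |deriv f t| ≤ C)
    (hae : ∀ᵐ t : ℝ ∂volume, t ∈ Icc p q → deriv f t ≤ 0) :
    AntitoneOn f (Icc p q) := by
  intro u hu v hv huv
  have hsub : Icc u v ⊆ Icc p q := Icc_subset_Icc hu.1 hv.2
  have hint : IntervalIntegrable (deriv f) volume u v := by
    rw [intervalIntegrable_iff_integrableOn_Icc_of_le huv]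
    refine Measure.integrableOn_of_bounded (M := C) ?_
      (measurable_deriv f).aestronglyMeasurable ?_
    · simp
    · rw [ae_restrict_iff' measurableSet_Icc]
      exact Eventually.of_forall fun t ht => hb t (hsub ht)
  have h1 := intervalIntegral.integral_eq_sub_of_hasDerivAt (f := f) (f' := deriv f) (a := u) (b := v)
    (fun t ht => (hd t (hsub (by rwa [uIcc_of_le huv] at ht))).hasDerivAt) hint
  have h2 : ∫ t in u..v, deriv f t ≤ ∫ t in u..v, (0:ℝ) := by
    refine intervalIntegral.integral_mono_ae_restrict huv hint (by simp) ?_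
    rw [EventuallyLE, ae_restrict_iff' measurableSet_Icc]
    filter_upwards [hae] with t ht ht'
    exact ht (hsub ht')
  simp at h2
  linarith

lemma aux_deriv_le {f : ℝ → ℝ} {p q C : ℝ} (hpq : p < q)
    (hd : ∀ t ∈ Icc p q, DifferentiableAt ℝ f t)
    (hb : ∀ t ∈ Icc p q, |deriv f t| ≤ C)
    (hae : ∀ᵐ t : ℝ ∂volume, t ∈ Icc p q → deriv f t ≤ 0) :
    ∀ t ∈ Icc p q, deriv f t ≤ 0 := by
  intro t ht
  rw [← (hd t ht).derivWithin (uniqueDiffOn_Icc hpq t ht)]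
  exact (aux_antitone hd hb hae).derivWithin_nonpos

lemma aux_max {z : ℝ → ℝ} {p q C R : ℝ}
    (hd : ∀ t ∈ Icc p q, DifferentiableAt ℝ z t)
    (hb : ∀ t ∈ Icc p q, |deriv z t| ≤ C)
    (hae : ∀ᵐ t : ℝ ∂volume, t ∈ Icc p q → R < z t → deriv z t ≤ 0)
    (h0 : z p ≤ R) : ∀ t ∈ Icc p q, z t ≤ R := by
  intro t ht
  by_contra! hlt
  have hc : ContinuousOn z (Icc p t) := fun u hu =>
    (hd u ⟨hu.1, hu.2.trans ht.2⟩).continuousAt.continuousWithinAt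
  set S := Icc p t ∩ z ⁻¹' (Iic R) with hS
  have hScl : IsClosed S := hc.preimage_isClosed_of_isClosed isClosed_Icc isClosed_Iic
  have hSne : S.Nonempty := ⟨p, ⟨le_rfl, ht.1⟩, h0⟩
  have hSb : BddAbove S := ⟨t, fun u hu => hu.1.2⟩
  have hm := hScl.csSup_mem hSne hSb
  set v := sSup S with hv
  have hsub : Icc v t ⊆ Icc p q := Icc_subset_Icc hm.1.1 ht.2
  have hanti : AntitoneOn z (Icc v t) := by
    refine aux_antitone (C := C) (fun u hu => hd u (hsub hu)) (fun u hu => hb u (hsub hu)) ?_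
    have hne : ∀ᵐ u : ℝ ∂volume, u ≠ v := by simp [ae_iff]
    filter_upwards [hae, hne] with u h1 h2 hu
    refine h1 (hsub hu) ?_
    by_contra! h3
    have : u ≤ v := le_csSup hSb ⟨⟨hm.1.1.trans hu.1, hu.2⟩, h3⟩
    exact h2 (le_antisymm this hu.1)
  have h4 := hanti ⟨le_rfl, hm.1.2⟩ ⟨hm.1.2, le_rfl⟩ hm.1.2
  have h5 : z v ≤ R := hm.2
  linarith

/-- all-points bound of a derivative from an almost-everywhere weighted bound -/
lemma aux_weighted {x : ℝ → ℝ} {s T γ C Y : ℝ} (hsT : s < T) (hγ : 0 < γ) (hY : 0 ≤ Y)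
    (hd : ∀ t ∈ Icc s T, DifferentiableAt ℝ x t)
    (hb : ∀ t ∈ Icc s T, |deriv x t| ≤ C)
    (hae : ∀ᵐ t : ℝ ∂volume, t ∈ Icc s T → deriv x t * exp (γ * (t - s)) ≤ Y) :
    ∀ t ∈ Icc s T, deriv x t * exp (γ * (t - s)) ≤ Y := by
  have hG : ∀ t : ℝ, HasDerivAt (fun u => -(Y / γ) * exp (-(γ * (u - s)))) (Y * exp (-(γ * (t - s)))) t := by
    intro t
    have h1 : HasDerivAt (fun u : ℝ => -(γ * (u - s))) (-(γ * 1)) t :=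
      (((hasDerivAt_id t).sub_const s).const_mul γ).neg
    have := (h1.exp).const_mul (-(Y / γ))
    refine this.congr_deriv ?_
    have h2 : Y / γ * γ = Y := div_mul_cancel₀ _ hγ.ne'
    linear_combination (exp (-(γ * (t - s)))) * h2
  have hF : ∀ t ∈ Icc s T, HasDerivAt (fun u => x u - (-(Y / γ) * exp (-(γ * (u - s)))))
      (deriv x t - Y * exp (-(γ * (t - s)))) t := fun t ht => (hd t ht).hasDerivAt.sub (hG t)
  have key : ∀ t : ℝ, deriv x t * exp (γ * (t - s)) ≤ Y ↔ deriv x t - Y * exp (-(γ * (t - s))) ≤ 0 := by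
    intro t
    rw [exp_neg, sub_nonpos, ← div_eq_mul_inv, le_div_iff₀ (exp_pos _)]
  have := aux_deriv_le (C := C + Y) hsT (fun t ht => (hF t ht).differentiableAt)
    (fun t ht => by
      rw [(hF t ht).deriv]
      have h1 : exp (-(γ * (t - s))) ≤ 1 := by
        rw [exp_le_one_iff]; have := mul_nonneg hγ.le (sub_nonneg.2 ht.1); linarith
      have h2 := hb t ht
      have h3 : |Y * exp (-(γ * (t - s)))| ≤ Y := by
        rw [abs_of_nonneg (mul_nonneg hY (exp_pos _).le)]; nlinarith
      exact (abs_sub _ _).trans (add_le_add h2 h3))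
    (by
      filter_upwards [hae] with t h1 ht
      rw [(hF t ht).deriv]
      exact (key t).1 (h1 ht))
  intro t ht
  have h := this t ht
  rw [(hF t ht).deriv] at h
  exact (key t).2 h

lemma aux_gamma {A0 S W α r : ℝ} (hα : 0 < α) (hA0' : A0 < 1)
    (hc : S / (1 - A0) * W < 1) :
    ∃ γ > 0, γ < α ∧ A0 * exp (γ * r) < 1 ∧
      (α / (α - γ)) * exp (γ * r) * W * (S * exp (γ * r) / (1 - A0 * exp (γ * r))) < 1 := by
  have c1 : ContinuousAt (fun γ : ℝ => A0 * exp (γ * r)) 0 := by fun_prop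
  have c2 : ContinuousAt (fun γ : ℝ => (α / (α - γ)) * exp (γ * r) * W *
      (S * exp (γ * r) / (1 - A0 * exp (γ * r)))) 0 := by
    have h1 : α - 0 ≠ 0 := by simpa using hα.ne'
    have h2 : 1 - A0 * exp (0 * r) ≠ 0 := by simp; linarith
    refine ContinuousAt.mul (ContinuousAt.mul (ContinuousAt.mul (ContinuousAt.div ?_ ?_ h1) ?_) ?_)
      (ContinuousAt.div ?_ ?_ h2) <;> fun_prop
  have e1 : ∀ᶠ γ in 𝓝 (0:ℝ), A0 * exp (γ * r) < 1 :=
    c1.eventually_lt continuousAt_const (by simpa using hA0')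
  have e2 : ∀ᶠ γ in 𝓝 (0:ℝ), (α / (α - γ)) * exp (γ * r) * W *
      (S * exp (γ * r) / (1 - A0 * exp (γ * r))) < 1 :=
    c2.eventually_lt continuousAt_const (by
      simp [hα.ne']; linarith)
  have e3 : ∀ᶠ γ in 𝓝 (0:ℝ), γ < α := eventually_lt_nhds hα
  have := ((e1.and (e2.and e3)).filter_mono nhdsWithin_le_nhds).and
    (self_mem_nhdsWithin : Ioi (0:ℝ) ∈ 𝓝[>] 0)
  obtain ⟨γ, ⟨h1, h2, h3⟩, h4⟩ := this.exists
  exact ⟨γ, h4, h3, h1, h2⟩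

set_option maxHeartbeats 1600000 in
/-- The core a priori estimate on `[s,T]`. -/
lemma aux_core
    (t0 : ℝ) (m : ℕ) (σ : ℝ) (hσ : 0 < σ) (τ : Fin m → ℝ) (hτ : ∀ k, 0 < τ k)
    (a g : ℝ → ℝ) (b h : Fin m → ℝ → ℝ)
    (hgdel : ∀ᵐ t : ℝ ∂volume, t0 ≤ t → 0 ≤ t - g t ∧ t - g t ≤ σ)
    (hhdel : ∀ᵐ t : ℝ ∂volume, t0 ≤ t → ∀ k, 0 ≤ t - h k t ∧ t - h k t ≤ τ k)
    (α A0 : ℝ) (B : Fin m → ℝ) (P : ℝ) (Q : Fin m → ℝ)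
    (hα : 0 < α) (hA0 : 0 ≤ A0)
    (hB : ∀ k, 0 ≤ B k) (hP : 0 ≤ P) (hQ : ∀ k, 0 ≤ Q k)
    (hae : ∀ᵐ t : ℝ ∂volume, t0 ≤ t →
      α ≤ ∑ k, b k t ∧ |a t| ≤ A0 ∧ (∀ k, |b k t| ≤ B k) ∧
      |a t| / (∑ k, b k t) ≤ P ∧ (∀ k, |b k t| / (∑ k, b k t) ≤ Q k))
    (r γ : ℝ) (hr1 : σ ≤ r) (hr2 : ∀ k, τ k ≤ r) (hγ : 0 < γ) (hγα : γ < α)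
    (s T : ℝ) (hs : t0 ≤ s) (hsT : s < T) (φ ψ x : ℝ → ℝ) (K : ℝ)
    (hφ : ∀ u ≤ s, |φ u| ≤ K) (hψ : ∀ u ≤ s, |ψ u| ≤ K)
    (hx : IsNeutralSolution m a b g h s φ ψ x)
    (X Y : ℝ) (hX : ∀ t ∈ Icc s T, |x t| * exp (γ * (t - s)) ≤ X)
    (hY : ∀ t ∈ Icc s T, |deriv x t| * exp (γ * (t - s)) ≤ Y) :
    (∀ t ∈ Icc s T, |deriv x t| * exp (γ * (t - s)) ≤
      exp (γ * r) * (A0 * (Y + K) + (∑ k, B k) * (X + K))) ∧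
    (∀ t ∈ Icc s T, |x t| * exp (γ * (t - s)) ≤
      K + α / (α - γ) * (exp (γ * r) * ((P + ∑ k, τ k * Q k) * Y + (P + 2 * ∑ k, Q k) * K))) := by
  obtain ⟨hx0, hxd, hxb, hxe⟩ := hx
  obtain ⟨C, hC⟩ := hxb T hsT.le
  have hK : 0 ≤ K := (abs_nonneg _).trans (hφ s le_rfl)
  have hsm : s ∈ Icc s T := ⟨le_rfl, hsT.le⟩
  have hX0 : 0 ≤ X := le_trans (by positivity) (hX s hsm)
  have hY0 : 0 ≤ Y := le_trans (by positivity) (hY s hsm)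
  set E := exp (γ * r) with hE
  have hE0 : 0 < E := exp_pos _
  have hr0 : 0 ≤ r := hσ.le.trans hr1
  have hE1 : 1 ≤ E := one_le_exp (mul_nonneg hγ.le hr0)
  have hd : ∀ t ∈ Icc s T, DifferentiableAt ℝ x t := fun t ht => hxd t ht.1
  -- comparing weights
  have hw : ∀ t v, t - v ≤ r → exp (γ * (t - s)) ≤ E * exp (γ * (v - s)) := by
    intro t v htv
    rw [hE, ← exp_add, exp_le_exp]
    nlinarith
  have hw' : ∀ t v, t - v ≤ r → v ≤ s → exp (γ * (t - s)) ≤ E := by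
    intro t v htv hv
    rw [hE, exp_le_exp]
    nlinarith
  have f1 : ∀ t ∈ Icc s T, ∀ v, 0 ≤ t - v → t - v ≤ r →
      |Dfun x ψ s v| * exp (γ * (t - s)) ≤ E * (Y + K) := by
    intro t ht v h1 h2
    unfold Dfun
    split_ifs with hv
    · have h3 := hY v ⟨hv, by linarith [ht.2]⟩
      calc |deriv x v| * exp (γ * (t - s)) ≤ |deriv x v| * (E * exp (γ * (v - s))) := by
            gcongr; exact hw t v h2
        _ = E * (|deriv x v| * exp (γ * (v - s))) := by ring
        _ ≤ E * (Y + K) := by gcongr; linarith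
    · push Not at hv
      calc |ψ v| * exp (γ * (t - s)) ≤ K * E := by
            gcongr
            · exact hψ v hv.le
            · exact hw' t v h2 hv.le
        _ ≤ E * (Y + K) := by nlinarith
  have f2 : ∀ t ∈ Icc s T, ∀ v, 0 ≤ t - v → t - v ≤ r →
      |x v| * exp (γ * (t - s)) ≤ E * (X + K) := by
    intro t ht v h1 h2
    rcases le_or_gt s v with hv | hv
    · have h3 := hX v ⟨hv, by linarith [ht.2]⟩
      calc |x v| * exp (γ * (t - s)) ≤ |x v| * (E * exp (γ * (v - s))) := by
            gcongr; exact hw t v h2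
        _ = E * (|x v| * exp (γ * (v - s))) := by ring
        _ ≤ E * (X + K) := by gcongr; linarith
    · calc |x v| * exp (γ * (t - s)) ≤ K * E := by
            gcongr
            · rw [hx0 v hv.le]; exact hφ v hv.le
            · exact hw' t v h2 hv.le
        _ ≤ E * (X + K) := by nlinarith
  have mv : ∀ t ∈ Icc s T, ∀ v, s ≤ v → v ≤ t →
      |x t - x v| * exp (γ * (v - s)) ≤ Y * (t - v) := by
    intro t ht v hv hvt
    have := (convex_Icc v t).norm_image_sub_le_of_norm_deriv_le (f := x)
      (C := Y * exp (-(γ * (v - s))))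
      (x := v) (y := t) (fun u hu => hxd u (hv.trans hu.1))
      (fun u hu => by
        have h1 := hY u ⟨hv.trans hu.1, hu.2.trans ht.2⟩
        rw [exp_neg, ← div_eq_mul_inv, le_div_iff₀ (exp_pos _)]
        refine le_trans ?_ h1
        rw [norm_eq_abs]
        gcongr
        exact hu.1) ⟨le_rfl, hvt⟩ ⟨hvt, le_rfl⟩
    rw [norm_eq_abs, norm_eq_abs, abs_of_nonneg (sub_nonneg.2 hvt)] at this
    calc |x t - x v| * exp (γ * (v - s))
        ≤ (Y * exp (-(γ * (v - s))) * (t - v)) * exp (γ * (v - s)) := by gcongr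
      _ = Y * (t - v) * (exp (-(γ * (v - s))) * exp (γ * (v - s))) := by ring
      _ = Y * (t - v) := by rw [← exp_add]; simp
  have f3 : ∀ t ∈ Icc s T, ∀ k, ∀ v, 0 ≤ t - v → t - v ≤ τ k →
      |x t - x v| * exp (γ * (t - s)) ≤ E * (τ k * Y + 2 * K) := by
    intro t ht k v h1 h2
    have h2' := h2.trans (hr2 k)
    rcases le_or_gt s v with hv | hv
    · have h3 := mv t ht v hv (by linarith)
      calc |x t - x v| * exp (γ * (t - s)) ≤ |x t - x v| * (E * exp (γ * (v - s))) := by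
            gcongr; exact hw t v h2'
        _ = E * (|x t - x v| * exp (γ * (v - s))) := by ring
        _ ≤ E * (τ k * Y + 2 * K) := by gcongr; nlinarith
    · have h3 := mv t ht s le_rfl ht.1
      simp only [sub_self, mul_zero, exp_zero, mul_one] at h3
      have h4 : |x s| ≤ K := by rw [hx0 s le_rfl]; exact hφ s le_rfl
      have h5 : |x v| ≤ K := by rw [hx0 v hv.le]; exact hφ v hv.le
      have h6 : |x t - x v| ≤ |x t - x s| + |x s| + |x v| := by
        have e : x t - x v = (x t - x s) + x s - x v := by ring
        rw [e]
        exact (abs_sub _ _).trans (add_le_add (abs_add_le _ _) le_rfl)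
      have h7 : |x t - x v| ≤ τ k * Y + 2 * K := by nlinarith
      have h8 := hw' t v h2' hv.le
      calc |x t - x v| * exp (γ * (t - s)) ≤ (τ k * Y + 2 * K) * E := by
            gcongr
            exact (abs_nonneg _).trans h7
        _ = _ := by ring
  -- equation
  have heq : ∀ᵐ t : ℝ ∂volume, t ∈ Icc s T →
      deriv x t = a t * Dfun x ψ s (g t) - ∑ k, b k t * x (h k t) := by
    filter_upwards [hxe] with t h1 ht
    have h2 := h1 ht.1
    have h3 : Dfun x ψ s t = deriv x t := by simp [Dfun, ht.1]
    rw [h3] at h2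
    linarith
  -- first bound, almost everywhere
  set Y' := E * (A0 * (Y + K) + (∑ k, B k) * (X + K)) with hY'
  have hSB : 0 ≤ ∑ k, B k := Finset.sum_nonneg fun k _ => hB k
  have hY'0 : 0 ≤ Y' := by positivity
  have g1 : ∀ᵐ t : ℝ ∂volume, t ∈ Icc s T → |deriv x t| * exp (γ * (t - s)) ≤ Y' := by
    filter_upwards [heq, hgdel, hhdel, hae] with t e1 e2 e3 e4 ht
    obtain ⟨e2a, e2b⟩ := e2 (hs.trans ht.1)
    have e3 := e3 (hs.trans ht.1)
    obtain ⟨-, ea, eb, -, -⟩ := e4 (hs.trans ht.1)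
    rw [e1 ht]
    have i1 : |a t * Dfun x ψ s (g t) - ∑ k, b k t * x (h k t)| ≤
        |a t| * |Dfun x ψ s (g t)| + ∑ k, |b k t| * |x (h k t)| := by
      refine (abs_sub _ _).trans (add_le_add (abs_mul _ _).le ?_)
      refine (Finset.abs_sum_le_sum_abs _ _).trans (le_of_eq ?_)
      simp only [abs_mul]
    calc _ ≤ (|a t| * |Dfun x ψ s (g t)| + ∑ k, |b k t| * |x (h k t)|) * exp (γ * (t - s)) := by
          gcongr
      _ = |a t| * (|Dfun x ψ s (g t)| * exp (γ * (t - s))) +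
          ∑ k, |b k t| * (|x (h k t)| * exp (γ * (t - s))) := by
          rw [add_mul, Finset.sum_mul]; simp only [mul_assoc]
      _ ≤ A0 * (E * (Y + K)) + ∑ k, B k * (E * (X + K)) := by
          refine add_le_add (mul_le_mul ea (f1 t ht _ e2a (e2b.trans hr1)) (by positivity) hA0) ?_
          refine Finset.sum_le_sum fun k _ => ?_
          exact mul_le_mul (eb k) (f2 t ht _ (e3 k).1 ((e3 k).2.trans (hr2 k))) (by positivity) (hB k)
      _ = Y' := by rw [hY', ← Finset.sum_mul]; ring
  set N := E * ((P + ∑ k, τ k * Q k) * Y + (P + 2 * ∑ k, Q k) * K) with hN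
  have hSQ : 0 ≤ ∑ k, Q k := Finset.sum_nonneg fun k _ => hQ k
  have hSQ' : 0 ≤ ∑ k, τ k * Q k := Finset.sum_nonneg fun k _ => mul_nonneg (hτ k).le (hQ k)
  have hN0 : 0 ≤ N := by positivity
  have g2 : ∀ᵐ t : ℝ ∂volume, t ∈ Icc s T → α ≤ ∑ k, b k t ∧
      |deriv x t + (∑ k, b k t) * x t| * exp (γ * (t - s)) ≤ (∑ k, b k t) * N := by
    filter_upwards [heq, hgdel, hhdel, hae] with t e1 e2 e3 e4 ht
    obtain ⟨e2a, e2b⟩ := e2 (hs.trans ht.1)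
    have e3 := e3 (hs.trans ht.1)
    obtain ⟨ebα, -, -, ea, eb⟩ := e4 (hs.trans ht.1)
    refine ⟨ebα, ?_⟩
    set β := ∑ k, b k t with hβ
    have hβ0 : 0 < β := hα.trans_le ebα
    rw [div_le_iff₀ hβ0] at ea
    have eb' : ∀ k, |b k t| ≤ Q k * β := fun k => (div_le_iff₀ hβ0).1 (eb k)
    have i0 : deriv x t + β * x t =
        a t * Dfun x ψ s (g t) + ∑ k, b k t * (x t - x (h k t)) := by
      rw [e1 ht, hβ, Finset.sum_mul]
      simp only [mul_sub, Finset.sum_sub_distrib]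
      ring
    have i1 : |a t * Dfun x ψ s (g t) + ∑ k, b k t * (x t - x (h k t))| ≤
        |a t| * |Dfun x ψ s (g t)| + ∑ k, |b k t| * |x t - x (h k t)| := by
      refine (abs_add_le _ _).trans (add_le_add (abs_mul _ _).le ?_)
      refine (Finset.abs_sum_le_sum_abs _ _).trans (le_of_eq ?_)
      simp only [abs_mul]
    rw [i0]
    calc _ ≤ (|a t| * |Dfun x ψ s (g t)| + ∑ k, |b k t| * |x t - x (h k t)|) *
          exp (γ * (t - s)) := by gcongr
      _ = |a t| * (|Dfun x ψ s (g t)| * exp (γ * (t - s))) +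
          ∑ k, |b k t| * (|x t - x (h k t)| * exp (γ * (t - s))) := by
          rw [add_mul, Finset.sum_mul]; simp only [mul_assoc]
      _ ≤ (P * β) * (E * (Y + K)) + ∑ k, (Q k * β) * (E * (τ k * Y + 2 * K)) := by
          refine add_le_add (mul_le_mul ea (f1 t ht _ e2a (e2b.trans hr1)) (by positivity)
            (by positivity)) ?_
          refine Finset.sum_le_sum fun k _ => ?_
          exact mul_le_mul (eb' k) (f3 t ht k _ (e3 k).1 (e3 k).2) (by positivity)
            (mul_nonneg (hQ k) hβ0.le)
      _ = β * N := by
          have : ∑ k, (Q k * β) * (E * (τ k * Y + 2 * K)) =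
              β * E * Y * (∑ k, τ k * Q k) + β * E * 2 * K * ∑ k, Q k := by
            rw [Finset.mul_sum, Finset.mul_sum, ← Finset.sum_add_distrib]
            refine Finset.sum_congr rfl fun k _ => by ring
          rw [this, hN]; ring
  set R := K + α / (α - γ) * N with hR
  have hαγ : 0 < α - γ := sub_pos.2 hγα
  have hlam : 0 ≤ α / (α - γ) := by positivity
  constructor
  · have p1 := aux_weighted (x := x) hsT hγ hY'0 hd hC (by
      filter_upwards [g1] with t h1 ht
      exact le_trans (by gcongr; exact le_abs_self _) (h1 ht))
    have p2 := aux_weighted (x := fun u => -x u) (C := C) hsT hγ hY'0 (fun t ht => (hd t ht).neg)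
      (by intro t ht; rw [deriv.fun_neg, abs_neg]; exact hC t ht) (by
      filter_upwards [g1] with t h1 ht
      rw [deriv.fun_neg]
      exact le_trans (by gcongr; exact neg_le_abs _) (h1 ht))
    intro t ht
    have q1 := p1 t ht
    have q2 := p2 t ht
    rw [deriv.fun_neg] at q2
    rcases abs_choice (deriv x t) with h | h <;> rw [h] <;> assumption
  · -- maximum principle, for `x` and `-x`
    have gen : ∀ y : ℝ → ℝ, (∀ t ∈ Icc s T, DifferentiableAt ℝ y t) →
        (∀ t ∈ Icc s T, |deriv y t| * exp (γ * (t - s)) ≤ Y) →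
        (∀ t ∈ Icc s T, |y t| * exp (γ * (t - s)) ≤ X) → (|y s| ≤ K) →
        (∀ᵐ t : ℝ ∂volume, t ∈ Icc s T → α ≤ ∑ k, b k t ∧
          (deriv y t + (∑ k, b k t) * y t) * exp (γ * (t - s)) ≤ (∑ k, b k t) * N) →
        ∀ t ∈ Icc s T, y t * exp (γ * (t - s)) ≤ R := by
      intro y yd yY yX ys yae
      have hz : ∀ t ∈ Icc s T, HasDerivAt (fun u => y u * exp (γ * (u - s)))
          (deriv y t * exp (γ * (t - s)) + γ * (y t * exp (γ * (t - s)))) t := by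
        intro t ht
        have h1 : HasDerivAt (fun u : ℝ => γ * (u - s)) (γ * 1) t :=
          ((hasDerivAt_id t).sub_const s).const_mul γ
        have := (yd t ht).hasDerivAt.mul h1.exp
        refine this.congr_deriv ?_
        ring
      refine aux_max (C := Y + γ * X) (fun t ht => (hz t ht).differentiableAt) ?_ ?_ ?_
      · intro t ht
        rw [(hz t ht).deriv]
        refine (abs_add_le _ _).trans (add_le_add ?_ ?_)
        · rw [abs_mul, abs_of_pos (exp_pos _)]; exact yY t ht
        · rw [abs_mul, abs_mul, abs_of_pos (exp_pos _), abs_of_pos hγ]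
          gcongr
          exact yX t ht
      · filter_upwards [yae] with t h1 ht hRz
        obtain ⟨h2, h3⟩ := h1 ht
        rw [(hz t ht).deriv]
        set β := ∑ k, b k t
        set z := y t * exp (γ * (t - s)) with hzz
        have h4 : deriv y t * exp (γ * (t - s)) ≤ β * N - β * z := by
          rw [hzz]; linarith
        have h5 : α / (α - γ) * N ≤ z := by linarith
        have h6 : α * N ≤ z * (α - γ) := by
          rwa [div_mul_eq_mul_div, div_le_iff₀ hαγ] at h5
        have h7 : N ≤ z := by
          have hz0 : 0 ≤ z := le_trans (by positivity) h5
          have : α * N ≤ α * z := by nlinarith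
          exact le_of_mul_le_mul_left this hα
        nlinarith [mul_le_mul_of_nonneg_left h7 (sub_nonneg.2 h2)]
      · simp only [sub_self, mul_zero, exp_zero, mul_one]
        have := le_abs_self (y s)
        have : 0 ≤ α / (α - γ) * N := by positivity
        linarith
    have hxs : |x s| ≤ K := by rw [hx0 s le_rfl]; exact hφ s le_rfl
    have p1 := gen x hd hY hX hxs (by
      filter_upwards [g2] with t h1 ht
      exact ⟨(h1 ht).1, le_trans (by gcongr; exact le_abs_self _) (h1 ht).2⟩)
    have p2 := gen (fun u => -x u) (fun t ht => (hd t ht).neg)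
      (by intro t ht; rw [deriv.fun_neg, abs_neg]; exact hY t ht)
      (by intro t ht; rw [abs_neg]; exact hX t ht) (by rwa [abs_neg]) (by
      filter_upwards [g2] with t h1 ht
      rw [deriv.fun_neg]
      refine ⟨(h1 ht).1, le_trans ?_ (h1 ht).2⟩
      gcongr
      have := neg_le_abs (deriv x t + (∑ k, b k t) * x t)
      linarith)
    intro t ht
    have q1 := p1 t ht
    have q2 := p2 t ht
    rcases abs_choice (x t) with h | h <;> rw [h] <;> assumption

end Helpers

/-- Theorem 4.2: a delay-independent exponential stability test for
`x'(t) - a(t) x'(g(t)) = -∑ b_k(t) x(h_k(t))`. -/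
theorem theorem4_2
    (t0 : ℝ) (ht0 : 0 ≤ t0) (m : ℕ) (hm : 1 ≤ m)
    (σ : ℝ) (hσ : 0 < σ) (τ : Fin m → ℝ) (hτ : ∀ k, 0 < τ k)
    (a g : ℝ → ℝ) (b h : Fin m → ℝ → ℝ)
    (ham : Measurable a) (hgm : Measurable g)
    (hbm : ∀ k, Measurable (b k)) (hhm : ∀ k, Measurable (h k))
    (hgdel : ∀ᵐ t : ℝ ∂volume, t0 ≤ t → 0 ≤ t - g t ∧ t - g t ≤ σ)
    (hhdel : ∀ᵐ t : ℝ ∂volume, t0 ≤ t → ∀ k, 0 ≤ t - h k t ∧ t - h k t ≤ τ k)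
    (α A0 : ℝ) (B : Fin m → ℝ) (P : ℝ) (Q : Fin m → ℝ)
    (hα : 0 < α) (hA0 : 0 ≤ A0) (hA0' : A0 < 1)
    (hB : ∀ k, 0 ≤ B k) (hP : 0 ≤ P) (hQ : ∀ k, 0 ≤ Q k)
    (hae : ∀ᵐ t : ℝ ∂volume, t0 ≤ t →
      α ≤ ∑ k, b k t ∧ |a t| ≤ A0 ∧ (∀ k, |b k t| ≤ B k) ∧
      |a t| / (∑ k, b k t) ≤ P ∧ (∀ k, |b k t| / (∑ k, b k t) ≤ Q k))
    (hcond : ((∑ k, B k) / (1 - A0)) * (P + ∑ k, τ k * Q k) < 1) :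
    UnifExpStable m a b g h t0 := by
  set r := σ + ∑ k, τ k with hr
  have hSτ : 0 ≤ ∑ k, τ k := Finset.sum_nonneg fun k _ => (hτ k).le
  have hr1 : σ ≤ r := by linarith
  have hr2 : ∀ k, τ k ≤ r := fun k => by
    have := Finset.single_le_sum (f := τ) (fun k _ => (hτ k).le) (Finset.mem_univ k)
    linarith
  obtain ⟨γ, hγ, hγα, hγ1, hγ2⟩ := aux_gamma (r := r) hα hA0' hcond
  set E := exp (γ * r) with hE
  have hE0 : 0 < E := exp_pos _
  set S := ∑ k, B k with hS
  set W := P + ∑ k, τ k * Q k with hW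
  set V := P + 2 * ∑ k, Q k with hV
  set l := α / (α - γ) with hl
  have hSB : 0 ≤ S := Finset.sum_nonneg fun k _ => hB k
  have hSQ : 0 ≤ ∑ k, Q k := Finset.sum_nonneg fun k _ => hQ k
  have hSQ' : 0 ≤ ∑ k, τ k * Q k := Finset.sum_nonneg fun k _ => mul_nonneg (hτ k).le (hQ k)
  have hW0 : 0 ≤ W := by positivity
  have hV0 : 0 ≤ V := by positivity
  have hl0 : 0 ≤ l := div_nonneg hα.le (sub_nonneg.2 hγα.le)
  have hq : 0 < 1 - A0 * E := sub_pos.2 hγ1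
  set c := l * E * W * (S * E / (1 - A0 * E)) with hc
  have hc1 : 0 < 1 - c := sub_pos.2 hγ2
  set C := 1 + l * E * V + l * E * W * ((A0 + S) * E / (1 - A0 * E)) with hC
  have hC0 : 0 < C := by positivity
  refine ⟨C / (1 - c), by positivity, γ, hγ, ?_⟩
  intro s hs φ ψ x hφ hψ hx t ht
  set K := ⨆ u : {u : ℝ // u ≤ s}, (|φ u.1| + |ψ u.1|) with hK
  have hbdd : BddAbove (Set.range fun u : {u : ℝ // u ≤ s} => |φ u.1| + |ψ u.1|) := by
    obtain ⟨C1, h1⟩ := hφ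
    obtain ⟨C2, h2⟩ := hψ
    refine ⟨C1 + C2, ?_⟩
    rintro _ ⟨u, rfl⟩
    exact add_le_add (h1 _) (h2 _)
  have hKu : ∀ u ≤ s, |φ u| + |ψ u| ≤ K := fun u hu => le_ciSup hbdd ⟨u, hu⟩
  have hφK : ∀ u ≤ s, |φ u| ≤ K := fun u hu => by
    have := hKu u hu; have := abs_nonneg (ψ u); linarith
  have hψK : ∀ u ≤ s, |ψ u| ≤ K := fun u hu => by
    have := hKu u hu; have := abs_nonneg (φ u); linarith
  set T := t + 1 with hT
  have hsT : s < T := by linarith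
  have hne : (Set.Icc s T).Nonempty := ⟨s, le_rfl, hsT.le⟩
  have hwb : ∀ u ∈ Set.Icc s T, exp (γ * (u - s)) ≤ exp (γ * (T - s)) := by
    intro u hu
    rw [exp_le_exp]
    exact mul_le_mul_of_nonneg_left (by linarith [hu.2]) hγ.le
  have bY : BddAbove ((fun u => |deriv x u| * exp (γ * (u - s))) '' Set.Icc s T) := by
    obtain ⟨C1, h1⟩ := hx.2.2.1 T hsT.le
    refine ⟨C1 * exp (γ * (T - s)), ?_⟩
    rintro _ ⟨u, hu, rfl⟩
    exact mul_le_mul (h1 u hu) (hwb u hu) (exp_pos _).le ((abs_nonneg _).trans (h1 u hu))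
  have bX : BddAbove ((fun u => |x u| * exp (γ * (u - s))) '' Set.Icc s T) := by
    refine (isCompact_Icc.image_of_continuousOn ?_).bddAbove
    intro u hu
    have : ContinuousAt x u := (hx.2.1 u hu.1).continuousAt
    exact ContinuousAt.continuousWithinAt (by fun_prop)
  set X := sSup ((fun u => |x u| * exp (γ * (u - s))) '' Set.Icc s T) with hXd
  set Y := sSup ((fun u => |deriv x u| * exp (γ * (u - s))) '' Set.Icc s T) with hYd
  have hX : ∀ u ∈ Set.Icc s T, |x u| * exp (γ * (u - s)) ≤ X := fun u hu =>
    le_csSup bX ⟨u, hu, rfl⟩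
  have hY : ∀ u ∈ Set.Icc s T, |deriv x u| * exp (γ * (u - s)) ≤ Y := fun u hu =>
    le_csSup bY ⟨u, hu, rfl⟩
  obtain ⟨r1, r2⟩ := aux_core t0 m σ hσ τ hτ a g b h hgdel hhdel α A0 B P Q hα hA0 hB hP hQ hae
    r γ hr1 hr2 hγ hγα s T hs hsT φ ψ x K hφK hψK hx X Y hX hY
  have s1 : Y ≤ E * (A0 * (Y + K) + S * (X + K)) := by
    refine csSup_le (hne.image _) ?_
    rintro _ ⟨u, hu, rfl⟩
    exact r1 u hu
  have s2 : X ≤ K + l * (E * (W * Y + V * K)) := by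
    refine csSup_le (hne.image _) ?_
    rintro _ ⟨u, hu, rfl⟩
    exact r2 u hu
  have s3 : Y ≤ S * E / (1 - A0 * E) * X + (A0 + S) * E / (1 - A0 * E) * K := by
    rw [div_mul_eq_mul_div, div_mul_eq_mul_div, ← add_div, le_div_iff₀ hq]
    linarith
  have s4 : X ≤ c * X + C * K := by
    have : l * E * W * Y ≤ l * E * W *
        (S * E / (1 - A0 * E) * X + (A0 + S) * E / (1 - A0 * E) * K) := by gcongr
    rw [hc, hC]
    linarith
  have s5 : X ≤ C / (1 - c) * K := by
    rw [div_mul_eq_mul_div, le_div_iff₀ hc1]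
    linarith
  have s6 := (hX t ⟨ht, by linarith⟩).trans s5
  rw [← le_div_iff₀ (exp_pos _)] at s6
  refine s6.trans (le_of_eq ?_)
  rw [neg_mul, exp_neg]
  ring
end

section
/- Let t0 ≥ 0, m ≥ 1, σ > 0, τ_1,…,τ_m > 0, and let a, g, h_1,…,h_m : ℝ → ℝ be Lebesgue measurable with 0 ≤ t − g(t) ≤ σ and 0 ≤ t − h_k(t) ≤ τ_k for almost every t ≥ t0. Let b_1,…,b_m > 0 be positive constants, and suppose there is a constant A0 < 1/2 with |a(t)| ≤ A0 for almost every t ≥ t0 and ∑_{k=1}^m b_k·τ_k < 1 − 2·A0. Then the neutral equation x'(t) − a(t)x'(g(t)) = −∑_{k=1}^m b_k·x(h_k(t)) is uniformly exponentially stable for initial times in [t0,∞). -/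
open MeasureTheory Real

lemma aux_antitone_s5 {F : ℝ → ℝ} {s T : ℝ}
    (hd : ∀ t ∈ Set.Icc s T, DifferentiableAt ℝ F t)
    (hbd : ∃ C : ℝ, ∀ t ∈ Set.Icc s T, |deriv F t| ≤ C)
    (hae : ∀ᵐ t : ℝ ∂volume, t ∈ Set.Icc s T → deriv F t ≤ 0) :
    AntitoneOn F (Set.Icc s T) := by
  intro u hu v hv huv
  obtain ⟨C, hC⟩ := hbd
  have hsub : ∀ t, t ∈ Set.Icc u v → t ∈ Set.Icc s T := fun t ht =>
    ⟨hu.1.trans ht.1, ht.2.trans hv.2⟩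
  have hint : IntervalIntegrable (deriv F) volume u v := by
    rw [intervalIntegrable_iff_integrableOn_Icc_of_le huv]
    refine Measure.integrableOn_of_bounded (M := C) (by simp)
      (measurable_deriv F).aestronglyMeasurable ?_
    rw [ae_restrict_iff' measurableSet_Icc]
    exact Filter.Eventually.of_forall fun t ht => hC t (hsub t ht)
  have h1 : ∫ t in u..v, deriv F t = F v - F u := by
    refine intervalIntegral.integral_eq_sub_of_hasDerivAt ?_ hint
    intro t ht
    rw [Set.uIcc_of_le huv] at ht
    exact (hd t (hsub t ht)).hasDerivAt
  have h2 : 0 ≤ ∫ t in u..v, - deriv F t := by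
    refine intervalIntegral.integral_nonneg_of_ae_restrict huv ?_
    refine (ae_restrict_iff' measurableSet_Icc).2 ?_
    filter_upwards [hae] with t ht htt
    have := ht (hsub t htt)
    simp only [Pi.zero_apply]
    linarith
  rw [intervalIntegral.integral_neg, h1] at h2
  linarith

lemma aux_deriv_nonpos {F : ℝ → ℝ} {s T : ℝ} (hsT : s < T)
    (hF : AntitoneOn F (Set.Icc s T)) {t : ℝ} (ht : t ∈ Set.Icc s T)
    (hd : DifferentiableAt ℝ F t) : deriv F t ≤ 0 := by
  rw [← hd.derivWithin (uniqueDiffOn_Icc hsT t ht)]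
  exact hF.derivWithin_nonpos

lemma hasDeriv_expo (c s t : ℝ) :
    HasDerivAt (fun u => Real.exp (c * (u - s))) (c * Real.exp (c * (t - s))) t := by
  have h1 : HasDerivAt (fun u : ℝ => c * (u - s)) c t := by
    simpa using ((hasDerivAt_id t).sub_const s).const_mul c
  simpa [mul_comm] using h1.exp

lemma expo_bdd (c s T : ℝ) : ∃ C : ℝ, ∀ t ∈ Set.Icc s T, |Real.exp (c * (t - s))| ≤ C := by
  have hc : ContinuousOn (fun t => Real.exp (c * (t - s))) (Set.Icc s T) := by fun_prop
  obtain ⟨C, hC⟩ := isCompact_Icc.exists_bound_of_continuousOn hc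
  exact ⟨C, fun t ht => hC t ht⟩

lemma lemA {f : ℝ → ℝ} {s T γ C : ℝ} (hsT : s < T) (hγ : 0 < γ)
    (hd : ∀ t ∈ Set.Icc s T, DifferentiableAt ℝ f t)
    (hbd : ∃ C : ℝ, ∀ t ∈ Set.Icc s T, |deriv f t| ≤ C)
    (hae : ∀ᵐ t : ℝ ∂volume, t ∈ Set.Icc s T → deriv f t ≤ C * Real.exp (-γ * (t - s))) :
    ∀ t ∈ Set.Icc s T, deriv f t ≤ C * Real.exp (-γ * (t - s)) := by
  set F : ℝ → ℝ := fun u => f u + C / γ * Real.exp (-γ * (u - s)) with hF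
  have hD : ∀ t ∈ Set.Icc s T, HasDerivAt F (deriv f t - C * Real.exp (-γ * (t - s))) t := by
    intro t ht
    have := (hd t ht).hasDerivAt.add ((hasDeriv_expo (-γ) s t).const_mul (C / γ))
    refine this.congr_deriv ?_
    field_simp
    ring
  have hanti : AntitoneOn F (Set.Icc s T) := by
    refine aux_antitone_s5 (fun t ht => (hD t ht).differentiableAt) ?_ ?_
    · obtain ⟨C1, h1⟩ := hbd
      obtain ⟨C2, h2⟩ := expo_bdd (-γ) s T
      refine ⟨C1 + |C| * C2, fun t ht => ?_⟩
      rw [(hD t ht).deriv]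
      refine (abs_sub _ _).trans (add_le_add (h1 t ht) ?_)
      rw [abs_mul]
      exact mul_le_mul_of_nonneg_left (h2 t ht) (abs_nonneg _)
    · filter_upwards [hae] with t ht htt
      rw [(hD t htt).deriv]
      linarith [ht htt]
  intro t ht
  have := aux_deriv_nonpos hsT hanti ht (hD t ht).differentiableAt
  rw [(hD t ht).deriv] at this
  linarith

lemma lemB {f : ℝ → ℝ} {s T γ b R : ℝ} (hγb : γ < b) (hR : 0 ≤ R)
    (hd : ∀ t ∈ Set.Icc s T, DifferentiableAt ℝ f t)
    (hbd : ∃ C : ℝ, ∀ t ∈ Set.Icc s T, |deriv f t| ≤ C)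
    (hae : ∀ᵐ t : ℝ ∂volume, t ∈ Set.Icc s T →
      deriv f t + b * f t ≤ R * Real.exp (-γ * (t - s))) :
    ∀ t ∈ Set.Icc s T, f t ≤ (|f s| + R / (b - γ)) * Real.exp (-γ * (t - s)) := by
  have hbg : 0 < b - γ := by linarith
  set F : ℝ → ℝ := fun u => f u * Real.exp (b * (u - s))
    - R / (b - γ) * Real.exp ((b - γ) * (u - s)) with hF
  have hD : ∀ t ∈ Set.Icc s T, HasDerivAt F ((deriv f t + b * f t) * Real.exp (b * (t - s))
      - R * Real.exp ((b - γ) * (t - s))) t := by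
    intro t ht
    have := ((hd t ht).hasDerivAt.mul (hasDeriv_expo b s t)).sub
      ((hasDeriv_expo (b - γ) s t).const_mul (R / (b - γ)))
    refine this.congr_deriv ?_
    field_simp
  have hsplit : ∀ t, Real.exp ((b - γ) * (t - s)) =
      Real.exp (-γ * (t - s)) * Real.exp (b * (t - s)) := by
    intro t
    rw [← Real.exp_add]; congr 1; ring
  have hanti : AntitoneOn F (Set.Icc s T) := by
    refine aux_antitone_s5 (fun t ht => (hD t ht).differentiableAt) ?_ ?_
    · obtain ⟨C1, h1⟩ := hbd
      obtain ⟨C2, h2⟩ := expo_bdd b s T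
      obtain ⟨C3, h3⟩ := expo_bdd (b - γ) s T
      have hc : ContinuousOn f (Set.Icc s T) := fun t ht =>
        (hd t ht).continuousAt.continuousWithinAt
      obtain ⟨C4, h4⟩ := isCompact_Icc.exists_bound_of_continuousOn hc
      refine ⟨(C1 + |b| * C4) * C2 + |R| * C3, fun t ht => ?_⟩
      rw [(hD t ht).deriv]
      have e1 := h1 t ht
      have e4 : |f t| ≤ C4 := h4 t ht
      have e5 : |deriv f t + b * f t| ≤ C1 + |b| * C4 := by
        refine (abs_add_le _ _).trans (add_le_add e1 ?_)
        rw [abs_mul]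
        exact mul_le_mul_of_nonneg_left e4 (abs_nonneg _)
      refine (abs_sub _ _).trans (add_le_add ?_ ?_)
      · rw [abs_mul]
        exact mul_le_mul e5 (h2 t ht) (abs_nonneg _) ((abs_nonneg _).trans e5)
      · rw [abs_mul]
        exact mul_le_mul_of_nonneg_left (h3 t ht) (abs_nonneg _)
    · filter_upwards [hae] with t ht htt
      rw [(hD t htt).deriv, hsplit]
      have := mul_le_mul_of_nonneg_right (ht htt) (Real.exp_pos (b * (t - s))).le
      linarith
  intro t ht
  have hst : s ≤ t := ht.1
  have h1 := hanti (Set.left_mem_Icc.2 (hst.trans ht.2)) ht hst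
  simp only [hF, sub_self, mul_zero, Real.exp_zero, mul_one] at h1
  have h0 : 0 ≤ R / (b - γ) := by positivity
  have h2 : f t * Real.exp (b * (t - s)) ≤
      |f s| + R / (b - γ) * Real.exp ((b - γ) * (t - s)) := by
    linarith [le_abs_self (f s)]
  have h3 : 1 ≤ Real.exp ((b - γ) * (t - s)) :=
    Real.one_le_exp (mul_nonneg hbg.le (by linarith))
  have h4 : f t * Real.exp (b * (t - s)) ≤
      ((|f s| + R / (b - γ)) * Real.exp (-γ * (t - s))) * Real.exp (b * (t - s)) := by
    rw [mul_assoc, ← hsplit]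
    nlinarith [abs_nonneg (f s)]
  exact le_of_mul_le_mul_right h4 (Real.exp_pos _)

/-- Two-sided version of `lemA`. -/
lemma lemA_abs {f : ℝ → ℝ} {s T γ C : ℝ} (hsT : s < T) (hγ : 0 < γ)
    (hd : ∀ t ∈ Set.Icc s T, DifferentiableAt ℝ f t)
    (hbd : ∃ C : ℝ, ∀ t ∈ Set.Icc s T, |deriv f t| ≤ C)
    (hae : ∀ᵐ t : ℝ ∂volume, t ∈ Set.Icc s T → |deriv f t| ≤ C * Real.exp (-γ * (t - s))) :
    ∀ t ∈ Set.Icc s T, |deriv f t| ≤ C * Real.exp (-γ * (t - s)) := by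
  intro t ht
  have h1 := lemA (C := C) hsT hγ hd hbd
    (by filter_upwards [hae] with u hu huu using (le_abs_self _).trans (hu huu)) t ht
  have h2 := lemA (f := -f) (C := C) hsT hγ (fun u hu => (hd u hu).neg)
    (by simpa [deriv.neg'] using hbd)
    (by filter_upwards [hae] with u hu huu
        rw [deriv.neg]
        exact (neg_le_abs _).trans (hu huu)) t ht
  rw [deriv.neg] at h2
  exact abs_le.2 ⟨by linarith, h1⟩

/-- Two-sided version of `lemB`. -/
lemma lemB_abs {f : ℝ → ℝ} {s T γ b R : ℝ} (hγb : γ < b) (hR : 0 ≤ R)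
    (hd : ∀ t ∈ Set.Icc s T, DifferentiableAt ℝ f t)
    (hbd : ∃ C : ℝ, ∀ t ∈ Set.Icc s T, |deriv f t| ≤ C)
    (hae : ∀ᵐ t : ℝ ∂volume, t ∈ Set.Icc s T →
      |deriv f t + b * f t| ≤ R * Real.exp (-γ * (t - s))) :
    ∀ t ∈ Set.Icc s T, |f t| ≤ (|f s| + R / (b - γ)) * Real.exp (-γ * (t - s)) := by
  intro t ht
  have h1 := lemB (R := R) hγb hR hd hbd
    (by filter_upwards [hae] with u hu huu using (le_abs_self _).trans (hu huu)) t ht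
  have h2 := lemB (f := -f) (R := R) hγb hR (fun u hu => (hd u hu).neg)
    (by simpa [deriv.neg'] using hbd)
    (by filter_upwards [hae] with u hu huu
        rw [deriv.neg]
        have := (neg_le_abs _).trans (hu huu)
        simp only [Pi.neg_apply]
        linarith) t ht
  simp only [Pi.neg_apply, abs_neg] at h2
  exact abs_le.2 ⟨by linarith, h1⟩

/-- Increment estimate with exponential weight. -/
lemma incr {f : ℝ → ℝ} {s T γ X u t : ℝ} (hγ : 0 < γ) (hX : 0 ≤ X)
    (hd : ∀ t ∈ Set.Icc s T, DifferentiableAt ℝ f t)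
    (hXb : ∀ t ∈ Set.Icc s T, |deriv f t| ≤ X * Real.exp (-γ * (t - s)))
    (hsu : s ≤ u) (hut : u ≤ t) (htT : t ≤ T) :
    |f t - f u| ≤ X * Real.exp (-γ * (u - s)) * (t - u) := by
  have h := (convex_Icc u t).norm_image_sub_le_of_norm_deriv_le (f := f)
    (C := X * Real.exp (-γ * (u - s))) (x := u) (y := t)
    (fun w hw => hd w ⟨hsu.trans hw.1, hw.2.trans htT⟩)
    (fun w hw => (hXb w ⟨hsu.trans hw.1, hw.2.trans htT⟩).trans
      (mul_le_mul_of_nonneg_left (Real.exp_le_exp.2 (by nlinarith [hw.1])) hX))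
    (Set.left_mem_Icc.2 hut) (Set.right_mem_Icc.2 hut)
  rwa [Real.norm_eq_abs, Real.norm_eq_abs, abs_of_nonneg (by linarith : 0 ≤ t - u)] at h

lemma exists_gamma {A0 B b L : ℝ} (hb : 0 < b) (h : B < 1 - 2 * A0) :
    ∃ γ > (0:ℝ), γ < b ∧ A0 * Real.exp (γ * L) + b * Real.exp (γ * L) *
      (A0 * Real.exp (γ * L) + Real.exp (γ * L) * B) / (b - γ) < 1 := by
  have hc : ContinuousAt (fun γ : ℝ => A0 * Real.exp (γ * L) + b * Real.exp (γ * L) *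
      (A0 * Real.exp (γ * L) + Real.exp (γ * L) * B) / (b - γ)) 0 := by
    refine ContinuousAt.add (by fun_prop) (ContinuousAt.div (by fun_prop) (by fun_prop) ?_)
    simpa using hb.ne'
  have h1 : ∀ᶠ γ in nhds (0:ℝ), A0 * Real.exp (γ * L) + b * Real.exp (γ * L) *
      (A0 * Real.exp (γ * L) + Real.exp (γ * L) * B) / (b - γ) < 1 := by
    refine hc.eventually_lt continuousAt_const ?_
    simp only [zero_mul, Real.exp_zero, mul_one, one_mul, sub_zero]
    rw [mul_div_cancel_left₀ _ hb.ne']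
    linarith
  have h2 : ∀ᶠ γ in nhds (0:ℝ), γ < b := eventually_lt_nhds hb
  have h3 := ((h1.and h2).filter_mono (nhdsWithin_le_nhds (s := Set.Ioi 0))).and
    self_mem_nhdsWithin
  obtain ⟨γ, ⟨ha, hb'⟩, hc'⟩ := h3.exists
  exact ⟨γ, hc', hb', ha⟩

/-- Corollary 4.1: exponential stability of
`x'(t) - a(t) x'(g(t)) = -∑ b_k x(h_k(t))` with positive constant coefficients
`b_k`, provided `‖a‖ < 1/2` and `∑ b_k τ_k < 1 - 2‖a‖`. -/
theorem corollary4_1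
    (t0 : ℝ) (ht0 : 0 ≤ t0) (m : ℕ) (hm : 1 ≤ m)
    (σ : ℝ) (hσ : 0 < σ) (τ : Fin m → ℝ) (hτ : ∀ k, 0 < τ k)
    (a g : ℝ → ℝ) (h : Fin m → ℝ → ℝ)
    (ham : Measurable a) (hgm : Measurable g) (hhm : ∀ k, Measurable (h k))
    (hgdel : ∀ᵐ t : ℝ ∂volume, t0 ≤ t → 0 ≤ t - g t ∧ t - g t ≤ σ)
    (hhdel : ∀ᵐ t : ℝ ∂volume, t0 ≤ t → ∀ k, 0 ≤ t - h k t ∧ t - h k t ≤ τ k)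
    (b : Fin m → ℝ) (hb : ∀ k, 0 < b k)
    (A0 : ℝ) (hA0 : A0 < 1 / 2)
    (ha : ∀ᵐ t : ℝ ∂volume, t0 ≤ t → |a t| ≤ A0)
    (hcond : ∑ k, b k * τ k < 1 - 2 * A0) :
    UnifExpStable m a (fun k _ => b k) g h t0 := by
  have hA0n : 0 ≤ A0 := by
    by_contra hneg
    have h1 : ∀ᵐ t : ℝ ∂volume, ¬ (t0 ≤ t) := by
      filter_upwards [ha] with t ht htt
      exact hneg ((abs_nonneg _).trans (ht htt))
    rw [ae_iff] at h1
    simp only [not_not] at h1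
    have : volume (Set.Ici t0) = 0 := h1
    simp at this
  have hne : (Finset.univ : Finset (Fin m)).Nonempty := ⟨⟨0, hm⟩, Finset.mem_univ _⟩
  set bs : ℝ := ∑ k, b k with hbs
  have hbpos : 0 < bs := Finset.sum_pos (fun k _ => hb k) hne
  set B : ℝ := ∑ k, b k * τ k with hB
  have hBn : 0 ≤ B := Finset.sum_nonneg fun k _ => (mul_pos (hb k) (hτ k)).le
  set L : ℝ := σ + ∑ k, τ k with hL
  have hsτ : 0 ≤ ∑ k, τ k := Finset.sum_nonneg fun k _ => (hτ k).le
  have hσL : σ ≤ L := by linarith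
  have hτL : ∀ k, τ k ≤ L := fun k => by
    have := Finset.single_le_sum (f := τ) (fun i _ => (hτ i).le) (Finset.mem_univ k)
    linarith
  obtain ⟨γ, hγ, hγb, hθ⟩ := exists_gamma (L := L) hbpos hcond
  set E : ℝ := Real.exp (γ * L) with hE
  have hEpos : 0 < E := Real.exp_pos _
  set θ : ℝ := A0 * E + bs * E * (A0 * E + E * B) / (bs - γ) with hθd
  have hbg : 0 < bs - γ := by linarith
  set c : ℝ := A0 * E + bs * E * (2 + (A0 * E + 2 * bs * E) / (bs - γ)) with hc
  have hcn : 0 ≤ c := by positivity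
  have h1θ : 0 < 1 - θ := by linarith
  refine ⟨1 + ((A0 * E + E * B) * (c / (1 - θ)) + (A0 * E + 2 * bs * E)) / (bs - γ),
    by positivity, γ, hγ, ?_⟩
  intro s hs φ ψ x hφ hψ hx t hst
  obtain ⟨hxφ, hxd, hxb, hxe⟩ := hx
  set N : ℝ := ⨆ u : {u : ℝ // u ≤ s}, (|φ u.1| + |ψ u.1|) with hN
  have hNb : ∀ u, u ≤ s → |φ u| + |ψ u| ≤ N := by
    intro u hu
    obtain ⟨C1, h1⟩ := hφ
    obtain ⟨C2, h2⟩ := hψ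
    refine le_ciSup (f := fun u : {u : ℝ // u ≤ s} => (|φ u.1| + |ψ u.1|)) ?_ ⟨u, hu⟩
    refine ⟨C1 + C2, ?_⟩
    rintro _ ⟨v, rfl⟩
    exact add_le_add (h1 _) (h2 _)
  have hN0 : 0 ≤ N := (add_nonneg (abs_nonneg _) (abs_nonneg _)).trans (hNb s le_rfl)
  have hφN : ∀ u, u ≤ s → |x u| ≤ N := fun u hu => by
    rw [hxφ u hu]; linarith [hNb u hu, abs_nonneg (ψ u)]
  have hψN : ∀ u, u ≤ s → |ψ u| ≤ N := fun u hu => by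
    linarith [hNb u hu, abs_nonneg (φ u)]
  set T : ℝ := t + 1 with hT
  have hsT : s < T := by linarith
  have hd : ∀ t ∈ Set.Icc s T, DifferentiableAt ℝ x t := fun t ht => hxd t ht.1
  have hbd := hxb T hsT.le
  -- the weighted sup of the derivative
  set S : Set ℝ := (fun t => |deriv x t| * Real.exp (γ * (t - s))) '' Set.Icc s T with hS
  have hSb : BddAbove S := by
    obtain ⟨C1, h1⟩ := hbd
    obtain ⟨C2, h2⟩ := expo_bdd γ s T
    refine ⟨C1 * C2, ?_⟩
    rintro _ ⟨u, hu, rfl⟩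
    have := h2 u hu
    rw [abs_of_pos (Real.exp_pos _)] at this
    exact mul_le_mul (h1 u hu) this (Real.exp_pos _).le ((abs_nonneg _).trans (h1 u hu))
  have hSne : S.Nonempty := ⟨_, Set.mem_image_of_mem _ (Set.left_mem_Icc.2 hsT.le)⟩
  set X : ℝ := sSup S with hX
  have hee : ∀ u : ℝ, Real.exp (γ * (u - s)) * Real.exp (-γ * (u - s)) = 1 := fun u => by
    rw [← Real.exp_add, ← Real.exp_zero]; congr 1; ring
  have hXb : ∀ u ∈ Set.Icc s T, |deriv x u| ≤ X * Real.exp (-γ * (u - s)) := by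
    intro u hu
    have h1 : |deriv x u| * Real.exp (γ * (u - s)) ≤ X :=
      le_csSup hSb (Set.mem_image_of_mem _ hu)
    have h2 := mul_le_mul_of_nonneg_right h1 (Real.exp_pos (-γ * (u - s))).le
    rwa [mul_assoc, hee, mul_one] at h2
  have hX0 : 0 ≤ X := by
    have h1 : |deriv x s| * Real.exp (γ * (s - s)) ≤ X :=
      le_csSup hSb (Set.mem_image_of_mem _ (Set.left_mem_Icc.2 hsT.le))
    exact le_trans (by positivity) h1
  -- weight comparison
  have hw : ∀ u v : ℝ, v - u ≤ L → Real.exp (-γ * (u - s)) ≤ E * Real.exp (-γ * (v - s)) := by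
    intro u v huv
    rw [hE, ← Real.exp_add]
    apply Real.exp_le_exp.2
    nlinarith
  have hw1 : ∀ u v : ℝ, v - u ≤ L → u ≤ s → 1 ≤ E * Real.exp (-γ * (v - s)) := by
    intro u v huv hus
    rw [hE, ← Real.exp_add]
    apply Real.one_le_exp
    nlinarith
  -- bound for the neutral term
  have hDg : ∀ᵐ u : ℝ ∂volume, u ∈ Set.Icc s T →
      |a u * Dfun x ψ s (g u)| ≤ A0 * E * (X + N) * Real.exp (-γ * (u - s)) := by
    filter_upwards [ha, hgdel] with u hau hgu huu
    have hau := hau (hs.trans huu.1)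
    obtain ⟨hg1, hg2⟩ := hgu (hs.trans huu.1)
    have hD : |Dfun x ψ s (g u)| ≤ (X + N) * (E * Real.exp (-γ * (u - s))) := by
      unfold Dfun
      split_ifs with hsg
      · have h1 := hXb (g u) ⟨hsg, by linarith [huu.2]⟩
        have h2 := hw (g u) u (by linarith)
        have h3 := mul_le_mul_of_nonneg_left h2 hX0
        have h4 : 0 ≤ N * (E * Real.exp (-γ * (u - s))) := by positivity
        linarith
      · push Not at hsg
        have h1 := hψN (g u) hsg.le
        have h2 := hw1 (g u) u (by linarith) hsg.le
        have h3 := mul_le_mul_of_nonneg_left h2 hN0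
        have h4 : 0 ≤ X * (E * Real.exp (-γ * (u - s))) := by positivity
        linarith
    rw [abs_mul]
    calc |a u| * |Dfun x ψ s (g u)| ≤ A0 * ((X + N) * (E * Real.exp (-γ * (u - s)))) :=
          mul_le_mul hau hD (abs_nonneg _) hA0n
      _ = _ := by ring
  -- bound for increments
  set R : ℝ := A0 * E * (X + N) + E * (B * X + 2 * bs * N) with hR
  have hR0 : 0 ≤ R := by positivity
  have hY : ∀ u ∈ Set.Icc s T, |x u| ≤ (|x s| + R / (bs - γ)) * Real.exp (-γ * (u - s)) := by
    refine lemB_abs hγb hR0 hd hbd ?_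
    filter_upwards [hDg, hhdel, hxe] with u hu1 hu2 hu3 huu
    have hu1 := hu1 huu
    have hu2 := hu2 (hs.trans huu.1)
    have hu3 := hu3 huu.1
    have hDu : Dfun x ψ s u = deriv x u := if_pos huu.1
    rw [hDu] at hu3
    have hk : ∀ k, |x u - x (h k u)| ≤ (τ k * X + 2 * N) * (E * Real.exp (-γ * (u - s))) := by
      intro k
      obtain ⟨hk1, hk2⟩ := hu2 k
      have hN4 : 0 ≤ 2 * N * (E * Real.exp (-γ * (u - s))) := by positivity
      rcases le_total s (h k u) with hsh | hsh
      · have h1 := incr hγ hX0 hd hXb hsh (by linarith) huu.2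
        have h2 := hw (h k u) u (hk2.trans (hτL k))
        have h3 : X * Real.exp (-γ * (h k u - s)) * (u - h k u) ≤
            X * (E * Real.exp (-γ * (u - s))) * τ k :=
          mul_le_mul (mul_le_mul_of_nonneg_left h2 hX0) hk2 hk1 (by positivity)
        linarith
      · have h1 := incr hγ hX0 hd hXb le_rfl huu.1 huu.2
        have h2 := hw1 (h k u) u (hk2.trans (hτL k)) hsh
        have h3 : X * Real.exp (-γ * (s - s)) * (u - s) ≤
            X * (E * Real.exp (-γ * (u - s))) * τ k := by
          refine mul_le_mul (mul_le_mul_of_nonneg_left ?_ hX0) (by linarith)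
            (by linarith [huu.1]) (by positivity)
          simpa using h2
        have h4 := mul_le_mul_of_nonneg_left h2 (by positivity : 0 ≤ 2 * N)
        have h5 : |x u - x (h k u)| ≤ |x u - x s| + (|x s| + |x (h k u)|) := by
          have e : x u - x (h k u) = (x u - x s) + (x s - x (h k u)) := by ring
          rw [e]
          exact (abs_add_le _ _).trans (add_le_add le_rfl (abs_sub _ _))
        linarith [hφN s le_rfl, hφN _ hsh]
    have hsum : deriv x u + bs * x u =
        a u * Dfun x ψ s (g u) + ∑ k, b k * (x u - x (h k u)) := by
      have : ∑ k, b k * (x u - x (h k u)) = bs * x u - ∑ k, b k * x (h k u) := by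
        rw [hbs, Finset.sum_mul, ← Finset.sum_sub_distrib]
        exact Finset.sum_congr rfl fun k _ => by ring
      rw [this]
      linarith
    rw [hsum]
    have hs2 : |∑ k, b k * (x u - x (h k u))| ≤
        E * (B * X + 2 * bs * N) * Real.exp (-γ * (u - s)) := by
      calc |∑ k, b k * (x u - x (h k u))| ≤ ∑ k, |b k * (x u - x (h k u))| :=
            Finset.abs_sum_le_sum_abs _ _
        _ ≤ ∑ k, b k * ((τ k * X + 2 * N) * (E * Real.exp (-γ * (u - s)))) := by
            refine Finset.sum_le_sum fun k _ => ?_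
            rw [abs_mul, abs_of_pos (hb k)]
            exact mul_le_mul_of_nonneg_left (hk k) (hb k).le
        _ = (∑ k, b k * τ k) * (X * (E * Real.exp (-γ * (u - s)))) +
            (∑ k, b k) * (2 * N * (E * Real.exp (-γ * (u - s)))) := by
            rw [Finset.sum_mul, Finset.sum_mul, ← Finset.sum_add_distrib]
            exact Finset.sum_congr rfl fun k _ => by ring
        _ = _ := by rw [← hB, ← hbs]; ring
    refine (abs_add_le _ _).trans ((add_le_add hu1 hs2).trans (le_of_eq ?_))
    rw [hR]; ring
  set Y : ℝ := N + R / (bs - γ) with hYd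
  have hRq : 0 ≤ R / (bs - γ) := by positivity
  have hY0 : 0 ≤ Y := by positivity
  have hY' : ∀ u ∈ Set.Icc s T, |x u| ≤ Y * Real.exp (-γ * (u - s)) := fun u hu =>
    (hY u hu).trans (mul_le_mul_of_nonneg_right (by linarith [hφN s le_rfl]) (Real.exp_pos _).le)
  have hder : ∀ u ∈ Set.Icc s T, |deriv x u| ≤
      (A0 * E * (X + N) + bs * E * (Y + N)) * Real.exp (-γ * (u - s)) := by
    refine lemA_abs hsT hγ hd hbd ?_
    filter_upwards [hDg, hhdel, hxe] with u hu1 hu2 hu3 huu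
    have hu1 := hu1 huu
    have hu2 := hu2 (hs.trans huu.1)
    have hu3 := hu3 huu.1
    have hDu : Dfun x ψ s u = deriv x u := if_pos huu.1
    rw [hDu] at hu3
    have hk : ∀ k, |x (h k u)| ≤ (Y + N) * (E * Real.exp (-γ * (u - s))) := by
      intro k
      obtain ⟨hk1, hk2⟩ := hu2 k
      rcases le_total s (h k u) with hsh | hsh
      · have h1 := hY' (h k u) ⟨hsh, by linarith [huu.2]⟩
        have h2 := mul_le_mul_of_nonneg_left (hw (h k u) u (hk2.trans (hτL k))) hY0
        have h4 : 0 ≤ N * (E * Real.exp (-γ * (u - s))) := by positivity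
        linarith
      · have h1 := hφN (h k u) hsh
        have h2 := mul_le_mul_of_nonneg_left (hw1 (h k u) u (hk2.trans (hτL k)) hsh) hN0
        have h4 : 0 ≤ Y * (E * Real.exp (-γ * (u - s))) := by positivity
        linarith
    have hs2 : |∑ k, b k * x (h k u)| ≤ bs * E * (Y + N) * Real.exp (-γ * (u - s)) := by
      calc |∑ k, b k * x (h k u)| ≤ ∑ k, |b k * x (h k u)| :=
            Finset.abs_sum_le_sum_abs _ _
        _ ≤ ∑ k, b k * ((Y + N) * (E * Real.exp (-γ * (u - s)))) := by
            refine Finset.sum_le_sum fun k _ => ?_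
            rw [abs_mul, abs_of_pos (hb k)]
            exact mul_le_mul_of_nonneg_left (hk k) (hb k).le
        _ = _ := by rw [← Finset.sum_mul, ← hbs]; ring
    have e : deriv x u = a u * Dfun x ψ s (g u) - ∑ k, b k * x (h k u) := by linarith
    rw [e]
    refine (abs_sub _ _).trans ((add_le_add hu1 hs2).trans (le_of_eq ?_))
    ring
  have hXle : X ≤ A0 * E * (X + N) + bs * E * (Y + N) := by
    refine csSup_le hSne ?_
    rintro _ ⟨u, hu, rfl⟩
    have h2 := mul_le_mul_of_nonneg_right (hder u hu) (Real.exp_pos (γ * (u - s))).le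
    rwa [mul_assoc, mul_comm (Real.exp (-γ * (u - s))), hee, mul_one] at h2
  have hXle2 : X ≤ θ * X + c * N := by
    refine hXle.trans (le_of_eq ?_)
    rw [hθd, hc, hYd, hR]
    field_simp
    ring
  have hXN : X ≤ c / (1 - θ) * N := by
    rw [div_mul_eq_mul_div, le_div_iff₀ h1θ]
    linarith
  have hfin := hY' t ⟨hst, by linarith⟩
  have hYN : Y ≤ (1 + ((A0 * E + E * B) * (c / (1 - θ)) + (A0 * E + 2 * bs * E)) / (bs - γ)) * N := by
    have h1 : R ≤ ((A0 * E + E * B) * (c / (1 - θ)) + (A0 * E + 2 * bs * E)) * N := by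
      have := mul_le_mul_of_nonneg_left hXN (by positivity : 0 ≤ A0 * E + E * B)
      rw [hR]
      linarith
    have h2 := div_le_div_of_nonneg_right h1 hbg.le
    rw [hYd, add_mul, one_mul, div_mul_eq_mul_div]
    linarith
  calc |x t| ≤ Y * Real.exp (-γ * (t - s)) := hfin
    _ ≤ _ := by
      have := mul_le_mul_of_nonneg_right hYN (Real.exp_pos (-γ * (t - s))).le
      linarith
end

section
/- Let t0 ≥ 0, σ > 0, τ > 0, and let a, b, g, h : ℝ → ℝ be Lebesgue measurable with 0 ≤ t − g(t) ≤ σ and 0 ≤ t − h(t) ≤ τ for almost every t ≥ t0. Suppose there exist constants b0 > 0, B ≥ 0, A0 ∈ [0,1) and R ≥ 0 such that for almost every t ≥ t0: b0 ≤ b(t) ≤ B, |a(t)| ≤ A0 and |a(t)|/b(t) ≤ R, and that B·τ ≤ 1/e and A0 + B·R < 1. Then the neutral equation x'(t) − a(t)x'(g(t)) = −b(t)·x(h(t)) is uniformly exponentially stable for initial times in [t0,∞). -/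
open MeasureTheory Real

/-- `x` is a solution on `[s,∞)` of the neutral equation
`x'(t) - a(t) x'(g(t)) = -b(t) x(h(t))` with initial data `(φ, ψ)`. -/
def IsNeutralSolution1 (a b g h : ℝ → ℝ) (s : ℝ) (φ ψ x : ℝ → ℝ) : Prop :=
  (∀ t ≤ s, x t = φ t) ∧
  (∀ t, s ≤ t → DifferentiableAt ℝ x t) ∧
  (∀ t1, s ≤ t1 → ∃ C : ℝ, ∀ t ∈ Set.Icc s t1, |deriv x t| ≤ C) ∧
  (∀ᵐ t : ℝ ∂volume, s ≤ t →
    Dfun x ψ s t - a t * Dfun x ψ s (g t) = -(b t * x (h t)))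

/-- Uniform exponential stability of the neutral equation
`x'(t) - a(t) x'(g(t)) = -b(t) x(h(t))` for initial times in `[t0,∞)`. -/
def UnifExpStable1 (a b g h : ℝ → ℝ) (t0 : ℝ) : Prop :=
  ∃ M > (0:ℝ), ∃ γ > (0:ℝ), ∀ s, t0 ≤ s → ∀ φ ψ x : ℝ → ℝ, Bdd φ → Bdd ψ →
    IsNeutralSolution1 a b g h s φ ψ x →
    ∀ t, s ≤ t →
      |x t| ≤ M * Real.exp (-γ * (t - s)) * ⨆ u : {u : ℝ // u ≤ s}, (|φ u.1| + |ψ u.1|)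


lemma aux_mono {s T : ℝ} {u : ℝ → ℝ}
    (hd : ∀ t ∈ Set.Icc s T, DifferentiableAt ℝ u t)
    (hb : ∃ C, ∀ t ∈ Set.Icc s T, |deriv u t| ≤ C)
    (hae : ∀ᵐ t : ℝ ∂volume, t ∈ Set.Icc s T → 0 ≤ deriv u t) :
    MonotoneOn u (Set.Icc s T) := by
  intro p hp q hq hpq
  obtain ⟨C, hC⟩ := hb
  have hsub : Set.uIcc p q ⊆ Set.Icc s T := by
    rw [Set.uIcc_of_le hpq]
    exact Set.Icc_subset_Icc hp.1 hq.2
  have hint : IntervalIntegrable (deriv u) volume p q := by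
    rw [intervalIntegrable_iff_integrableOn_Icc_of_le hpq]
    refine Measure.integrableOn_of_bounded (M := C) (by simp) 
      (measurable_deriv u).aestronglyMeasurable ?_
    rw [ae_restrict_iff' measurableSet_Icc]
    refine Filter.Eventually.of_forall fun t ht => ?_
    exact hC t ⟨hp.1.trans ht.1, ht.2.trans hq.2⟩
  have h1 := intervalIntegral.integral_eq_sub_of_hasDerivAt (a := p) (b := q)
    (fun t ht => (hd t (hsub ht)).hasDerivAt) hint
  have h2 : 0 ≤ ∫ t in p..q, deriv u t := by
    apply intervalIntegral.integral_nonneg_of_ae_restrict hpq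
    rw [Filter.EventuallyLE, ae_restrict_iff' measurableSet_Icc]
    filter_upwards [hae] with t ht h'
    exact ht ⟨hp.1.trans h'.1, h'.2.trans hq.2⟩
  linarith

lemma aux_everywhere {s T : ℝ} (hsT : s < T) {u : ℝ → ℝ}
    (hd : ∀ t ∈ Set.Icc s T, DifferentiableAt ℝ u t)
    (hb : ∃ C, ∀ t ∈ Set.Icc s T, |deriv u t| ≤ C)
    (hae : ∀ᵐ t : ℝ ∂volume, t ∈ Set.Icc s T → 0 ≤ deriv u t) :
    ∀ t ∈ Set.Icc s T, 0 ≤ deriv u t := by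
  intro t ht
  have hm := aux_mono hd hb hae
  have := hm.derivWithin_nonneg (x := t)
  rwa [(hd t ht).derivWithin (uniqueDiffOn_Icc hsT t ht)] at this

lemma hasDerivAt_expK (K γ s t : ℝ) :
    HasDerivAt (fun t => K * Real.exp (γ * (t - s))) (K * γ * Real.exp (γ * (t - s))) t := by
  have h1 : HasDerivAt (fun t => γ * (t - s)) (γ * 1) t :=
    ((hasDerivAt_id t).sub_const s).const_mul γ
  exact (h1.exp.const_mul K).congr_deriv (by ring)

lemma bdd_expK (K γ s T : ℝ) :
    ∃ C, ∀ t ∈ Set.Icc s T, |K * Real.exp (γ * (t - s))| ≤ C := by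
  have : ContinuousOn (fun t => K * Real.exp (γ * (t - s))) (Set.Icc s T) := by fun_prop
  exact isCompact_Icc.exists_bound_of_continuousOn this

/-- If the derivative is a.e. below `K exp (γ (t-s))`, it is so everywhere. -/
lemma aux_deriv_le_s7 {s T : ℝ} (hsT : s < T) {x : ℝ → ℝ} {K γ : ℝ} (hγ : γ ≠ 0)
    (hd : ∀ t ∈ Set.Icc s T, DifferentiableAt ℝ x t)
    (hb : ∃ C, ∀ t ∈ Set.Icc s T, |deriv x t| ≤ C)
    (hae : ∀ᵐ t : ℝ ∂volume, t ∈ Set.Icc s T → |deriv x t| ≤ K * Real.exp (γ * (t - s))) :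
    ∀ t ∈ Set.Icc s T, |deriv x t| ≤ K * Real.exp (γ * (t - s)) := by
  obtain ⟨C, hC⟩ := hb
  obtain ⟨C', hC'⟩ := bdd_expK K γ s T
  have hE : ∀ t, HasDerivAt (fun t => K / γ * Real.exp (γ * (t - s)))
      (K * Real.exp (γ * (t - s))) t := by
    intro t
    have := hasDerivAt_expK (K / γ) γ s t
    rwa [div_mul_cancel₀ _ hγ] at this
  have key : ∀ (c : ℝ), |c| = 1 → ∀ t ∈ Set.Icc s T, 
      c * deriv x t ≤ K * Real.exp (γ * (t - s)) := by
    intro c hc t ht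
    have hdu : ∀ t ∈ Set.Icc s T, HasDerivAt
        (fun t => K / γ * Real.exp (γ * (t - s)) - c * x t)
        (K * Real.exp (γ * (t - s)) - c * deriv x t) t := fun t ht =>
      (hE t).sub ((hd t ht).hasDerivAt.const_mul c)
    have h3 := aux_everywhere hsT (fun t ht => (hdu t ht).differentiableAt)
      ⟨C' + C, fun t ht => by
        rw [(hdu t ht).deriv]
        have h9 : |c * deriv x t| ≤ C := by
          rw [abs_mul, hc, one_mul]
          exact hC t ht
        exact (abs_sub _ _).trans (add_le_add (hC' t ht) h9)⟩
      (by
        filter_upwards [hae] with t h1 ht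
        rw [(hdu t ht).deriv]
        have h2 := h1 ht
        have h4 : c * deriv x t ≤ |deriv x t| := by
          refine (le_abs_self _).trans ?_
          rw [abs_mul, hc, one_mul]
        linarith) t ht
    rw [(hdu t ht).deriv] at h3
    linarith
  intro t ht
  have h1 := key 1 (by simp) t ht
  have h2 := key (-1) (by simp) t ht
  exact abs_le.2 ⟨by linarith, by linarith⟩

/-- A contraction principle for suprema. -/
lemma aux_contract {s T : ℝ} (hsT : s ≤ T) {f : ℝ → ℝ} {θ D : ℝ} (hθ : θ < 1)
    (hf : ∃ C, ∀ t ∈ Set.Icc s T, f t ≤ C) (hf0 : ∀ t, 0 ≤ f t)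
    (hstep : ∀ N, 0 ≤ N → (∀ t ∈ Set.Icc s T, f t ≤ N) → ∀ t ∈ Set.Icc s T, f t ≤ θ * N + D) :
    ∀ t ∈ Set.Icc s T, f t ≤ D / (1 - θ) := by
  obtain ⟨C, hC⟩ := hf
  have hbdd : BddAbove (f '' Set.Icc s T) := ⟨C, by rintro _ ⟨t, ht, rfl⟩; exact hC t ht⟩
  have hne : (f '' Set.Icc s T).Nonempty := ⟨f s, s, ⟨le_rfl, hsT⟩, rfl⟩
  have hle : ∀ t ∈ Set.Icc s T, f t ≤ sSup (f '' Set.Icc s T) := fun t ht =>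
    le_csSup hbdd ⟨t, ht, rfl⟩
  have hN : sSup (f '' Set.Icc s T) ≤ θ * sSup (f '' Set.Icc s T) + D := by
    apply csSup_le hne
    rintro _ ⟨t, ht, rfl⟩
    exact hstep _ ((hf0 s).trans (hle s ⟨le_rfl, hsT⟩)) hle t ht
  intro t ht
  refine (hle t ht).trans ?_
  rw [le_div_iff₀ (by linarith)]
  nlinarith

lemma aux_pos {s T τ B : ℝ} {w b h : ℝ → ℝ} (hB : 0 ≤ B)
    (hd : ∀ t ∈ Set.Icc s T, DifferentiableAt ℝ w t)
    (hb : ∃ C, ∀ t ∈ Set.Icc s T, |deriv w t| ≤ C) (hws : 0 ≤ w s)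
    (hBτ : B * τ ≤ 1 / Real.exp 1)
    (hae : ∀ᵐ t : ℝ ∂volume, t ∈ Set.Icc s T → 0 ≤ b t ∧ b t ≤ B ∧ 0 ≤ t - h t ∧ t - h t ≤ τ ∧
      -(b t * (if s ≤ h t then w (h t) else 0)) ≤ deriv w t) :
    ∀ t ∈ Set.Icc s T, 0 ≤ w t := by
  intro t1 ht1
  set lam := Real.exp 1 * B with hlam
  have hlam0 : 0 ≤ lam := by positivity
  have hlt : lam * τ ≤ 1 := by
    rw [le_div_iff₀ (Real.exp_pos 1)] at hBτ
    rw [hlam]; linarith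
  have hcont : ContinuousOn (fun t => Real.exp (lam * (t - s)) * w t) (Set.Icc s t1) := by
    apply ContinuousOn.mul (by fun_prop)
    exact fun t ht => (hd t ⟨ht.1, ht.2.trans ht1.2⟩).continuousAt.continuousWithinAt
  obtain ⟨t2, ht2, hmax⟩ := isCompact_Icc.exists_isMaxOn
    (Set.nonempty_Icc.2 ht1.1) hcont
  have hmax' : ∀ t ∈ Set.Icc s t1, Real.exp (lam * (t - s)) * w t ≤
     Real.exp (lam * (t2 - s)) * w t2 := fun t ht => hmax ht
  set V := Real.exp (lam * (t2 - s)) * w t2 with hV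
  have hV0 : 0 ≤ V := by
    have := hmax' s ⟨le_rfl, ht1.1⟩
    simp at this
    linarith
  have hw : ∀ t ∈ Set.Icc s t1, w t ≤ V * Real.exp ((-lam) * (t - s)) := by
    intro t ht
    have := hmax' t ht
    rw [neg_mul, Real.exp_neg, ← div_eq_mul_inv, le_div_iff₀ (Real.exp_pos _)]
    linarith
  have hw2 : w t2 = V * Real.exp ((-lam) * (t2 - s)) := by
    rw [neg_mul, Real.exp_neg, ← div_eq_mul_inv, eq_div_iff (Real.exp_pos _).ne']
    rw [hV]; ring
  have hsub : Set.Icc t2 t1 ⊆ Set.Icc s T := Set.Icc_subset_Icc ht2.1 ht1.2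
  have hdu : ∀ t ∈ Set.Icc t2 t1, HasDerivAt (fun t => w t - V * Real.exp ((-lam) * (t - s)))
      (deriv w t - V * (-lam) * Real.exp ((-lam) * (t - s))) t := fun t ht =>
    (hd t (hsub ht)).hasDerivAt.sub (hasDerivAt_expK V (-lam) s t)
  obtain ⟨C, hC⟩ := hb
  obtain ⟨C', hC'⟩ := bdd_expK (V * (-lam)) (-lam) s T
  have hm := aux_mono (s := t2) (T := t1) (fun t ht => (hdu t ht).differentiableAt)
    ⟨C + C', fun t ht => by
      rw [(hdu t ht).deriv]
      exact (abs_sub _ _).trans (add_le_add (hC t (hsub ht)) (hC' t (hsub ht)))⟩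
    (by
      filter_upwards [hae] with t h1 ht
      obtain ⟨hb0, hbB, hh0, hhτ, hder⟩ := h1 (hsub ht)
      rw [(hdu t ht).deriv]
      have hE := Real.exp_pos ((-lam) * (t - s))
      have h5 : b t * (if s ≤ h t then w (h t) else 0) ≤ 
          V * lam * Real.exp ((-lam) * (t - s)) := by
        have h6 : (if s ≤ h t then w (h t) else 0) ≤ 
            V * (Real.exp 1 * Real.exp ((-lam) * (t - s))) := by
          split_ifs with hs
          · refine (hw (h t) ⟨hs, by linarith [ht.2]⟩).trans ?_
            apply mul_le_mul_of_nonneg_left _ hV0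
            rw [← Real.exp_add]
            apply Real.exp_le_exp.2
            have := mul_le_mul_of_nonneg_left hhτ hlam0
            nlinarith
          · positivity
        calc _ ≤ b t * (V * (Real.exp 1 * Real.exp ((-lam) * (t - s)))) :=
              mul_le_mul_of_nonneg_left h6 hb0
          _ ≤ B * (V * (Real.exp 1 * Real.exp ((-lam) * (t - s)))) :=
              mul_le_mul_of_nonneg_right hbB (by positivity)
          _ = _ := by rw [hlam]; ring
      linarith)
  have h7 := hm ⟨le_rfl, ht2.2⟩ ⟨ht2.2, le_rfl⟩ ht2.2
  simp only at h7
  have : 0 ≤ V * Real.exp ((-lam) * (t1 - s)) := by positivity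
  linarith

lemma aux_upper {s T τ B b0 K G C ε γ : ℝ} {y b h : ℝ → ℝ} (hB : 0 ≤ B) (hb0 : 0 < b0)
    (hε : 0 ≤ ε) (hγ : 0 ≤ γ) (hC : 0 ≤ C)
    (hd : ∀ t ∈ Set.Icc s T, DifferentiableAt ℝ y t)
    (hb : ∃ C, ∀ t ∈ Set.Icc s T, |deriv y t| ≤ C) (hys : y s ≤ C)
    (hBτ : B * τ ≤ 1 / Real.exp 1)
    (hCK : K ≤ C * (1 - γ * (1 + ε) / b0))
    (hpos : 0 ≤ ε * Real.exp (-τ) - γ * (1 + ε))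
    (hCG : G ≤ C * Real.exp (-γ * τ) * (ε * Real.exp (-τ) - γ * (1 + ε)))
    (hae : ∀ᵐ t : ℝ ∂volume, t ∈ Set.Icc s T → b0 ≤ b t ∧ b t ≤ B ∧ 0 ≤ t - h t ∧ t - h t ≤ τ ∧
      (s ≤ h t → deriv y t ≤ b t * (K * Real.exp (-γ * (t - s))) - b t * y (h t)) ∧
      (t ≤ s + τ → deriv y t ≤ G)) :
    ∀ t ∈ Set.Icc s T, y t ≤ (1 + ε) * C * Real.exp (-γ * (t - s)) := by
  set p : ℝ → ℝ := fun t => C * (1 + ε) * Real.exp (-γ * (t - s)) 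
    - C * ε * Real.exp ((-γ - 1) * (t - s)) with hp
  have hpd : ∀ t, HasDerivAt p (C * (1 + ε) * (-γ) * Real.exp (-γ * (t - s)) 
    - C * ε * (-γ - 1) * Real.exp ((-γ - 1) * (t - s))) t := fun t =>
    (hasDerivAt_expK _ _ s t).sub (hasDerivAt_expK _ _ s t)
  have hsplit : ∀ t, Real.exp ((-γ - 1) * (t - s)) = 
      Real.exp (-γ * (t - s)) * Real.exp (-(t - s)) := fun t => by
    rw [← Real.exp_add]; congr 1; ring
  have hplow : ∀ t, s ≤ t → C * Real.exp (-γ * (t - s)) ≤ p t := by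
    intro t ht
    have h1 : Real.exp (-(t - s)) ≤ 1 := Real.exp_le_one_iff.2 (by linarith)
    have h2 : 0 ≤ C * ε * Real.exp (-γ * (t - s)) := by positivity
    simp only [hp, hsplit]
    nlinarith
  have hdu : ∀ t ∈ Set.Icc s T, HasDerivAt (fun t => p t - y t) 
     (C * (1 + ε) * (-γ) * Real.exp (-γ * (t - s)) 
    - C * ε * (-γ - 1) * Real.exp ((-γ - 1) * (t - s)) - deriv y t) t := fun t ht =>
    (hpd t).sub (hd t ht).hasDerivAt
  obtain ⟨C1, hC1⟩ := hb
  obtain ⟨C2, hC2⟩ := bdd_expK (C * (1 + ε) * (-γ)) (-γ) s T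
  obtain ⟨C3, hC3⟩ := bdd_expK (C * ε * (-γ - 1)) (-γ - 1) s T
  have key := aux_pos (s := s) (T := T) (τ := τ) (B := B) (w := fun t => p t - y t)
    (b := b) (h := h) hB (fun t ht => (hdu t ht).differentiableAt)
    ⟨C2 + C3 + C1, fun t ht => by
      rw [(hdu t ht).deriv]
      refine (abs_sub _ _).trans (add_le_add ((abs_sub _ _).trans (add_le_add ?_ ?_)) ?_)
      exacts [hC2 t ht, hC3 t ht, hC1 t ht]⟩
    (by
      have := hplow s le_rfl
      simp only [sub_self, mul_zero, Real.exp_zero, mul_one] at this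
      linarith)
    hBτ
    (by
      filter_upwards [hae] with t h1 ht
      obtain ⟨hbl, hbB, hh0, hhτ, hy1, hy2⟩ := h1 ht
      refine ⟨by linarith, hbB, hh0, hhτ, ?_⟩
      rw [(hdu t ht).deriv, hsplit]
      set E := Real.exp (-γ * (t - s)) with hE
      have hE0 : 0 < E := Real.exp_pos _
      split_ifs with hs
      · have h2 := hy1 hs
        have h3 := hplow (h t) hs
        have h4 : E ≤ Real.exp (-γ * (h t - s)) := by
          apply Real.exp_le_exp.2
          nlinarith
        have h5 : C * E ≤ p (h t) := (mul_le_mul_of_nonneg_left h4 hC).trans h3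
        have h6 : b t * (C * E) ≤ b t * p (h t) :=
          mul_le_mul_of_nonneg_left h5 (by linarith)
        have h7 : b t * (K * E) ≤ b t * (C * (1 - γ * (1 + ε) / b0) * E) := 
          mul_le_mul_of_nonneg_left (mul_le_mul_of_nonneg_right hCK hE0.le) (by linarith)
        have h8 : γ * (1 + ε) ≤ b t * (γ * (1 + ε) / b0) := by
          rw [← mul_div_assoc, le_div_iff₀ hb0]
          have : 0 ≤ γ * (1 + ε) := by positivity
          nlinarith
        have h9 : C * E * (γ * (1 + ε)) ≤ C * E * (b t * (γ * (1 + ε) / b0)) :=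
          mul_le_mul_of_nonneg_left h8 (by positivity)
        have h10 : 0 ≤ C * ε * (γ + 1) * (E * Real.exp (-(t - s))) := by positivity
        nlinarith
      · push Not at hs
        have h2 := hy2 (by linarith)
        have h3 : Real.exp (-τ) ≤ Real.exp (-(t - s)) := Real.exp_le_exp.2 (by linarith)
        have h4 : Real.exp (-γ * τ) ≤ E := by
          apply Real.exp_le_exp.2
          nlinarith
        have h5 : C * Real.exp (-γ * τ) * (ε * Real.exp (-τ) - γ * (1 + ε)) ≤
           C * E * (ε * Real.exp (-τ) - γ * (1 + ε)) := 
          mul_le_mul_of_nonneg_right (mul_le_mul_of_nonneg_left h4 hC) hpos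
        have h6 : C * E * ε * Real.exp (-τ) ≤ C * E * ε * Real.exp (-(t - s)) :=
          mul_le_mul_of_nonneg_left h3 (by positivity)
        have h7 : 0 ≤ C * E * ε * γ * Real.exp (-(t - s)) := by positivity
        nlinarith)
  intro t ht
  have h1 := key t ht
  simp only [hp] at h1
  have h2 : 0 ≤ C * ε * Real.exp ((-γ - 1) * (t - s)) := by positivity
  linarith

lemma aux_contract2 {s T : ℝ} (hsT : s < T) {x : ℝ → ℝ} {θ D γ : ℝ} (hθ : θ < 1) (hγ : γ ≠ 0)
    (hd : ∀ t ∈ Set.Icc s T, DifferentiableAt ℝ x t)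
    (hb : ∃ C, ∀ t ∈ Set.Icc s T, |deriv x t| ≤ C)
    (hstep : ∀ N, 0 ≤ N → (∀ t ∈ Set.Icc s T, |deriv x t| ≤ N * Real.exp (γ * (t - s))) →
      ∀ᵐ t : ℝ ∂volume, t ∈ Set.Icc s T →
        |deriv x t| ≤ (θ * N + D) * Real.exp (γ * (t - s))) :
    ∀ t ∈ Set.Icc s T, |deriv x t| ≤ D / (1 - θ) * Real.exp (γ * (t - s)) := by
  have hiff : ∀ t N, |deriv x t| / Real.exp (γ * (t - s)) ≤ N ↔
      |deriv x t| ≤ N * Real.exp (γ * (t - s)) := fun t N => div_le_iff₀ (Real.exp_pos _)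
  have key := aux_contract hsT.le (f := fun t => |deriv x t| / Real.exp (γ * (t - s)))
    (θ := θ) (D := D) hθ ?_ (fun t => by positivity) ?_
  · intro t ht
    exact (hiff _ _).1 (key t ht)
  · obtain ⟨C, hC⟩ := hb
    obtain ⟨C', hC'⟩ := bdd_expK 1 (-γ) s T
    refine ⟨C * C', fun t ht => ?_⟩
    have h1 := hC' t ht
    rw [one_mul, neg_mul, Real.exp_neg] at h1
    have h2 := hC t ht
    have h3 := (le_abs_self _).trans h1
    rw [div_eq_mul_inv]
    exact mul_le_mul h2 h3 (by positivity) ((abs_nonneg _).trans h2)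
  · intro N hN hle t ht
    refine (hiff _ _).2 ?_
    exact aux_deriv_le_s7 hsT hγ hd hb
      (hstep N hN fun t ht => (hiff _ _).1 (hle t ht)) t ht

lemma aux_crude {s T L S σ τ b0 B A0 R : ℝ} {a b g h x D : ℝ → ℝ} (hsT : s < T) (hL : 0 < L)
    (hS : 0 ≤ S) (hb0 : 0 < b0) (hθ : A0 + B / L < 1)
    (hA0 : 0 ≤ A0) (hB : 0 ≤ B)
    (hd : ∀ t ∈ Set.Icc s T, DifferentiableAt ℝ x t)
    (hb : ∃ C, ∀ t ∈ Set.Icc s T, |deriv x t| ≤ C)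
    (hf : ∀ᵐ t : ℝ ∂volume, s ≤ t → (0 ≤ t - g t ∧ t - g t ≤ σ) ∧ (0 ≤ t - h t ∧ t - h t ≤ τ) ∧
      b0 ≤ b t ∧ b t ≤ B ∧ |a t| ≤ A0 ∧ |a t| ≤ b t * R ∧
      deriv x t = a t * D (g t) - b t * x (h t))
    (hDs : ∀ u, s ≤ u → D u = deriv x u) (hDl : ∀ u, u < s → |D u| ≤ S)
    (hxl : ∀ u, u ≤ s → |x u| ≤ S) :
    ∀ t ∈ Set.Icc s T, |deriv x t| ≤ (A0 + B) * S / (1 - (A0 + B / L)) *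
      Real.exp (L * (t - s)) := by
  refine aux_contract2 hsT hθ hL.ne' hd hb ?_
  intro N hN hle
  have hE : ∀ t, HasDerivAt (fun t => N / L * Real.exp (L * (t - s)))
      (N * Real.exp (L * (t - s))) t := by
    intro t
    have := hasDerivAt_expK (N / L) L s t
    rwa [div_mul_cancel₀ _ hL.ne'] at this
  obtain ⟨C, hC⟩ := hb
  obtain ⟨C', hC'⟩ := bdd_expK N L s T
  have key : ∀ (c : ℝ), |c| = 1 → ∀ t ∈ Set.Icc s T,
      c * x t ≤ S + N / L * Real.exp (L * (t - s)) := by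
    intro c hc t ht
    have hle' : ∀ t, c * deriv x t ≤ |deriv x t| := fun t => by
      refine (le_abs_self _).trans ?_
      rw [abs_mul, hc, one_mul]
    have hdu : ∀ t ∈ Set.Icc s T, HasDerivAt
        (fun t => N / L * Real.exp (L * (t - s)) - c * x t)
        (N * Real.exp (L * (t - s)) - c * deriv x t) t := fun t ht =>
      (hE t).sub ((hd t ht).hasDerivAt.const_mul c)
    have h3 := aux_mono (fun t ht => (hdu t ht).differentiableAt)
      ⟨C' + C, fun t ht => by
        rw [(hdu t ht).deriv]
        have h9 : |c * deriv x t| ≤ C := by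
          rw [abs_mul, hc, one_mul]
          exact hC t ht
        exact (abs_sub _ _).trans (add_le_add (hC' t ht) h9)⟩
      (Filter.Eventually.of_forall fun t ht => by
        rw [(hdu t ht).deriv]
        linarith [hle t ht, hle' t]) ⟨le_rfl, hsT.le⟩ ht ht.1
    simp only [sub_self, mul_zero, Real.exp_zero, mul_one] at h3
    have h4 : c * x s ≤ S := by
      refine (le_abs_self _).trans ?_
      rw [abs_mul, hc, one_mul]
      exact hxl s le_rfl
    have h5 : 0 ≤ N / L := by positivity
    linarith
  have hxb : ∀ t ∈ Set.Icc s T, |x t| ≤ S + N / L * Real.exp (L * (t - s)) := by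
    intro t ht
    have h1 := key 1 (by simp) t ht
    have h2 := key (-1) (by simp) t ht
    exact abs_le.2 ⟨by linarith, by linarith⟩
  filter_upwards [hf] with t h1 ht
  obtain ⟨⟨hg0, hgσ⟩, ⟨hh0, hhτ⟩, hbl, hbB, haA, haR, hder⟩ := h1 ht.1
  have hE1 : 1 ≤ Real.exp (L * (t - s)) :=
    Real.one_le_exp (mul_nonneg hL.le (by linarith [ht.1]))
  have hEm : ∀ u, u ≤ t → Real.exp (L * (u - s)) ≤ Real.exp (L * (t - s)) := fun u hu =>
    Real.exp_le_exp.2 (mul_le_mul_of_nonneg_left (by linarith) hL.le)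
  have hD : |D (g t)| ≤ (N + S) * Real.exp (L * (t - s)) := by
    by_cases hs : s ≤ g t
    · rw [hDs _ hs]
      have h2 := hle (g t) ⟨hs, by linarith [ht.2]⟩
      have h3 := mul_le_mul_of_nonneg_left (hEm (g t) (by linarith)) hN
      nlinarith
    · have := hDl (g t) (not_le.1 hs)
      nlinarith
  have hX : |x (h t)| ≤ (S + N / L) * Real.exp (L * (t - s)) := by
    have h5 : 0 ≤ N / L := by positivity
    by_cases hs : s ≤ h t
    · have h2 := hxb (h t) ⟨hs, by linarith [ht.2]⟩
      have h3 := mul_le_mul_of_nonneg_left (hEm (h t) (by linarith)) h5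
      nlinarith
    · have := hxl (h t) (not_le.1 hs).le
      nlinarith
  have h6 : |a t * D (g t)| ≤ A0 * ((N + S) * Real.exp (L * (t - s))) := by
    rw [abs_mul]; exact mul_le_mul haA hD (abs_nonneg _) hA0
  have h7 : |b t * x (h t)| ≤ B * ((S + N / L) * Real.exp (L * (t - s))) := by
    rw [abs_mul, abs_of_nonneg (by linarith : 0 ≤ b t)]
    exact mul_le_mul hbB hX (abs_nonneg _) hB
  rw [hder]
  refine (abs_sub _ _).trans ((add_le_add h6 h7).trans (le_of_eq ?_))
  ring

lemma aux_delay {s t u γ σ P S f : ℝ} (hγ : 0 ≤ γ) (hP : 0 ≤ P) (hS : 0 ≤ S)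
    (hut : t - u ≤ σ)
    (h1 : s ≤ u → |f| ≤ P * Real.exp (-γ * (u - s))) (h2 : u < s → |f| ≤ S) :
    |f| ≤ Real.exp (γ * σ) * (P + S) * Real.exp (-γ * (t - s)) := by
  have hE : Real.exp (γ * σ) * (P + S) * Real.exp (-γ * (t - s)) = 
     (P + S) * Real.exp (γ * σ + -γ * (t - s)) := by rw [Real.exp_add]; ring
  rw [hE]
  by_cases hs : s ≤ u
  · have h3 : Real.exp (-γ * (u - s)) ≤ Real.exp (γ * σ + -γ * (t - s)) :=
      Real.exp_le_exp.2 (by nlinarith)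
    have h4 := h1 hs
    have h5 := Real.exp_pos (-γ * (u - s))
    nlinarith
  · have h3 : 1 ≤ Real.exp (γ * σ + -γ * (t - s)) :=
      Real.one_le_exp (by nlinarith [not_le.1 hs])
    have h4 := h2 (not_le.1 hs)
    nlinarith

lemma aux_xbound {s T S σ τ b0 B A0 R ε γ G N C : ℝ} {a b g h x D : ℝ → ℝ} 
    (hS : 0 ≤ S) (hb0 : 0 < b0) (hB : 0 ≤ B) (hN : 0 ≤ N)
    (hε : 0 ≤ ε) (hγ : 0 ≤ γ) (hSC : S ≤ C)
    (hBτ : B * τ ≤ 1 / Real.exp 1)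
    (hCK : R * Real.exp (γ * σ) * (N + S) ≤ C * (1 - γ * (1 + ε) / b0))
    (hpos : 0 ≤ ε * Real.exp (-τ) - γ * (1 + ε))
    (hCG : G ≤ C * Real.exp (-γ * τ) * (ε * Real.exp (-τ) - γ * (1 + ε)))
    (hG : ∀ t ∈ Set.Icc s T, t ≤ s + τ → |deriv x t| ≤ G)
    (hd : ∀ t ∈ Set.Icc s T, DifferentiableAt ℝ x t)
    (hb : ∃ C, ∀ t ∈ Set.Icc s T, |deriv x t| ≤ C)
    (hf : ∀ᵐ t : ℝ ∂volume, s ≤ t → (0 ≤ t - g t ∧ t - g t ≤ σ) ∧ (0 ≤ t - h t ∧ t - h t ≤ τ) ∧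
      b0 ≤ b t ∧ b t ≤ B ∧ |a t| ≤ A0 ∧ |a t| ≤ b t * R ∧
      deriv x t = a t * D (g t) - b t * x (h t))
    (hDs : ∀ u, s ≤ u → D u = deriv x u) (hDl : ∀ u, u < s → |D u| ≤ S)
    (hxl : ∀ u, u ≤ s → |x u| ≤ S)
    (hle : ∀ t ∈ Set.Icc s T, |deriv x t| ≤ N * Real.exp (-γ * (t - s))) :
    ∀ t ∈ Set.Icc s T, |x t| ≤ (1 + ε) * C * Real.exp (-γ * (t - s)) := by
  have key : ∀ c : ℝ, |c| = 1 → ∀ t ∈ Set.Icc s T, 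
      c * x t ≤ (1 + ε) * C * Real.exp (-γ * (t - s)) := by
    intro c hc
    have habs : ∀ z, c * z ≤ |z| := fun z => by
      refine (le_abs_self _).trans ?_
      rw [abs_mul, hc, one_mul]
    have hdu : ∀ t ∈ Set.Icc s T, HasDerivAt (fun t => c * x t) (c * deriv x t) t :=
      fun t ht => (hd t ht).hasDerivAt.const_mul c
    obtain ⟨C1, hC1⟩ := hb
    refine aux_upper (K := R * Real.exp (γ * σ) * (N + S)) (G := G) (b := b) (h := h) (τ := τ)
      (B := B) (b0 := b0) hB hb0 hε hγ (hS.trans hSC)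
      (fun t ht => (hdu t ht).differentiableAt) ⟨C1, fun t ht => ?_⟩ ?_ hBτ hCK hpos hCG ?_
    · rw [(hdu t ht).deriv, abs_mul, hc, one_mul]
      exact hC1 t ht
    · exact ((habs _).trans (hxl s le_rfl)).trans hSC
    · filter_upwards [hf] with t h1 ht
      obtain ⟨⟨hg0, hgσ⟩, ⟨hh0, hhτ⟩, hbl, hbB, haA, haR, hder⟩ := h1 ht.1
      refine ⟨hbl, hbB, hh0, hhτ, fun _ => ?_, fun htτ => ?_⟩
      · rw [(hdu t ht).deriv, hder]
        have hD : |D (g t)| ≤ Real.exp (γ * σ) * (N + S) * Real.exp (-γ * (t - s)) :=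
          aux_delay hγ hN hS hgσ (fun hs => by
            rw [hDs _ hs]; exact hle _ ⟨hs, by linarith [ht.2]⟩) (hDl _)
        have h6 : |a t * D (g t)| ≤ b t * R * 
            (Real.exp (γ * σ) * (N + S) * Real.exp (-γ * (t - s))) := by
          rw [abs_mul]
          exact mul_le_mul haR hD (abs_nonneg _) ((abs_nonneg _).trans haR)
        have h7 := (habs _).trans h6
        linarith
      · rw [(hdu t ht).deriv]
        exact (habs _).trans (hG t ht htτ)
  intro t ht
  have h1 := key 1 (by simp) t ht
  have h2 := key (-1) (by simp) t ht
  exact abs_le.2 ⟨by linarith, by linarith⟩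

lemma aux_params {σ τ b0 B A0 R : ℝ} (hb0 : 0 < b0) (hcond2 : A0 + B * R < 1) :
    ∃ ε γ : ℝ, 0 < ε ∧ 0 < γ ∧ 0 < 1 - γ * (1 + ε) / b0 ∧
      0 < ε * Real.exp (-τ) - γ * (1 + ε) ∧
      A0 * Real.exp (γ * σ) + B * Real.exp (γ * τ) * ((1 + ε) * 
        (R * Real.exp (γ * σ) / (1 - γ * (1 + ε) / b0))) < 1 := by
  set κ := Real.exp (-τ) / 4 with hκ
  have hκ0 : 0 < κ := by positivity
  have c1 : ContinuousAt (fun ε : ℝ => 1 - (κ * ε) * (1 + ε) / b0) 0 := by fun_prop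
  have c2 : ContinuousAt (fun ε : ℝ => A0 * Real.exp ((κ * ε) * σ) + 
      B * Real.exp ((κ * ε) * τ) * ((1 + ε) * 
        (R * Real.exp ((κ * ε) * σ) / (1 - (κ * ε) * (1 + ε) / b0)))) 0 := by
    have : (fun ε : ℝ => 1 - (κ * ε) * (1 + ε) / b0) 0 ≠ 0 := by simp
    have c3 : ContinuousAt (fun ε : ℝ => R * Real.exp ((κ * ε) * σ) / 
      (1 - (κ * ε) * (1 + ε) / b0)) 0 := ContinuousAt.div (by fun_prop) c1 this
    fun_prop
  have e1 := c1.eventually (lt_mem_nhds (a := 0) (by simp))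
  have e2 := c2.eventually_lt (continuousAt_const (y := (1:ℝ))) (by simpa using hcond2)
  have e3 : ∀ᶠ ε : ℝ in nhds 0, ε < 1 := gt_mem_nhds (by norm_num)
  obtain ⟨ε, ⟨⟨h1, h2⟩, h3⟩, h4⟩ := 
    ((((e1.and e2).and e3).filter_mono nhdsWithin_le_nhds).and 
      (self_mem_nhdsWithin : Set.Ioi (0:ℝ) ∈ nhdsWithin 0 (Set.Ioi 0))).exists
  have h4' : 0 < ε := h4
  refine ⟨ε, κ * ε, h4', by positivity, h1, ?_, h2⟩
  have : Real.exp (-τ) = 4 * κ := by rw [hκ]; ring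
  rw [this]
  have : 0 < κ * ε := by positivity
  nlinarith

/-- Condition (5.1) of Proposition 5.1: an exponential stability test for
`x'(t) - a(t) x'(g(t)) = -b(t) x(h(t))`. -/
theorem proposition5_1_condition1
    (t0 : ℝ) (ht0 : 0 ≤ t0) (σ τ : ℝ) (hσ : 0 < σ) (hτ : 0 < τ)
    (a b g h : ℝ → ℝ)
    (ham : Measurable a) (hbm : Measurable b) (hgm : Measurable g) (hhm : Measurable h)
    (hgdel : ∀ᵐ t : ℝ ∂volume, t0 ≤ t → 0 ≤ t - g t ∧ t - g t ≤ σ)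
    (hhdel : ∀ᵐ t : ℝ ∂volume, t0 ≤ t → 0 ≤ t - h t ∧ t - h t ≤ τ)
    (b0 B A0 R : ℝ) (hb0 : 0 < b0) (hB : 0 ≤ B) (hA0 : 0 ≤ A0) (hA0' : A0 < 1)
    (hR : 0 ≤ R)
    (hae : ∀ᵐ t : ℝ ∂volume, t0 ≤ t →
      b0 ≤ b t ∧ b t ≤ B ∧ |a t| ≤ A0 ∧ |a t| / b t ≤ R)
    (hcond1 : B * τ ≤ 1 / Real.exp 1)
    (hcond2 : A0 + B * R < 1) :
    UnifExpStable1 a b g h t0 := by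
  obtain ⟨ε, γ, hε, hγ, hη, hω, hθ⟩ := aux_params (σ := σ) (τ := τ) hb0 hcond2
  set η := 1 - γ * (1 + ε) / b0 with hηdef
  set ω := Real.exp (-γ * τ) * (ε * Real.exp (-τ) - γ * (1 + ε)) with hωdef
  have hω0 : 0 < ω := by positivity
  set L := 2 * B / (1 - A0) + 1 with hLdef
  have h1A : 0 < 1 - A0 := by linarith
  have hL : 0 < L := by positivity
  have hθ0 : A0 + B / L < 1 := by
    have : B / L < 1 - A0 := by
      rw [div_lt_iff₀ hL, hLdef, mul_add, mul_div_cancel₀ _ h1A.ne']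
      linarith
    linarith
  have h1θ0 : 0 < 1 - (A0 + B / L) := by linarith
  set c0 := (A0 + B) / (1 - (A0 + B / L)) * Real.exp (L * τ) with hc0
  have hc00 : 0 ≤ c0 := by positivity
  set θ := A0 * Real.exp (γ * σ) + B * Real.exp (γ * τ) * ((1 + ε) * 
        (R * Real.exp (γ * σ) / η)) with hθdef
  have h1θ : 0 < 1 - θ := by linarith
  set d0 := A0 * Real.exp (γ * σ) + B * Real.exp (γ * τ) * ((1 + ε) * 
    (R * Real.exp (γ * σ) / η + c0 / ω + 1) + 1) with hd0
  have hd00 : 0 ≤ d0 := by positivity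
  set N0 := d0 / (1 - θ) with hN0
  have hN00 : 0 ≤ N0 := by positivity
  refine ⟨(1 + ε) * (R * Real.exp (γ * σ) * (N0 + 1) / η + c0 / ω + 1), by positivity,
    γ, hγ, ?_⟩
  intro s hs φ ψ x hφ hψ hx t hst
  obtain ⟨hxφ, hxd, hxb, hxe⟩ := hx
  set S := ⨆ u : {u : ℝ // u ≤ s}, (|φ u.1| + |ψ u.1|) with hSdef
  have hSle : ∀ u, u ≤ s → |φ u| + |ψ u| ≤ S := by
    intro u hu
    obtain ⟨C1, hC1⟩ := hφ
    obtain ⟨C2, hC2⟩ := hψ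
    have hbd : BddAbove (Set.range fun u : {u : ℝ // u ≤ s} => |φ u.1| + |ψ u.1|) :=
      ⟨C1 + C2, by rintro _ ⟨v, rfl⟩; exact add_le_add (hC1 _) (hC2 _)⟩
    exact le_ciSup hbd ⟨u, hu⟩
  have hS : 0 ≤ S := le_trans (by positivity) (hSle s le_rfl)
  have hxl : ∀ u, u ≤ s → |x u| ≤ S := fun u hu => by
    rw [hxφ u hu]; linarith [hSle u hu, abs_nonneg (ψ u)]
  have hDs : ∀ u, s ≤ u → Dfun x ψ s u = deriv x u := fun u hu => by simp [Dfun, hu]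
  have hDl : ∀ u, u < s → |Dfun x ψ s u| ≤ S := fun u hu => by
    simp only [Dfun, not_le.2 hu, if_false]
    linarith [hSle u hu.le, abs_nonneg (φ u)]
  have hf : ∀ᵐ t : ℝ ∂volume, s ≤ t → (0 ≤ t - g t ∧ t - g t ≤ σ) ∧
      (0 ≤ t - h t ∧ t - h t ≤ τ) ∧
      b0 ≤ b t ∧ b t ≤ B ∧ |a t| ≤ A0 ∧ |a t| ≤ b t * R ∧
      deriv x t = a t * Dfun x ψ s (g t) - b t * x (h t) := by
    filter_upwards [hgdel, hhdel, hae, hxe] with t h1 h2 h3 h4 ht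
    obtain ⟨h5, h6, h7, h8⟩ := h3 (hs.trans ht)
    refine ⟨h1 (hs.trans ht), h2 (hs.trans ht), h5, h6, h7, ?_, ?_⟩
    · rw [div_le_iff₀ (by linarith)] at h8
      linarith
    · have := h4 ht
      rw [hDs t ht] at this
      linarith
  set T := t + 1 with hT
  have hsT : s < T := by linarith
  have hd : ∀ t ∈ Set.Icc s T, DifferentiableAt ℝ x t := fun t ht => hxd t ht.1
  have hb := hxb T hsT.le
  have hcr := aux_crude hsT hL hS hb0 hθ0 hA0 hB hd hb hf hDs hDl hxl
  have hG : ∀ t ∈ Set.Icc s T, t ≤ s + τ → |deriv x t| ≤ c0 * S := by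
    intro t ht htτ
    refine (hcr t ht).trans ?_
    have h1 : Real.exp (L * (t - s)) ≤ Real.exp (L * τ) :=
      Real.exp_le_exp.2 (mul_le_mul_of_nonneg_left (by linarith) hL.le)
    refine (mul_le_mul_of_nonneg_left h1 (by positivity)).trans (le_of_eq ?_)
    rw [hc0]; ring
  have hX : ∀ N, 0 ≤ N → (∀ t ∈ Set.Icc s T, |deriv x t| ≤ N * Real.exp (-γ * (t - s))) →
      ∀ t ∈ Set.Icc s T, |x t| ≤ (1 + ε) * 
        (R * Real.exp (γ * σ) * (N + S) / η + c0 * S / ω + S) * Real.exp (-γ * (t - s)) := by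
    intro N hN hle
    have e1 : 0 ≤ R * Real.exp (γ * σ) * (N + S) / η := by positivity
    have e2 : 0 ≤ c0 * S / ω := by positivity
    refine aux_xbound hS hb0 hB hN hε.le hγ.le (by linarith) hcond1 ?_ hω.le ?_ hG hd hb hf
      hDs hDl hxl hle
    · rw [← hηdef, ← div_le_iff₀ hη]
      linarith
    · rw [mul_assoc _ (Real.exp (-γ * τ)) _, ← hωdef, ← div_le_iff₀ hω0]
      linarith
  have hfin := aux_contract2 (D := d0 * S) hsT hθ (by linarith : -γ ≠ 0) hd hb (by
    intro N hN hle
    have hXN := hX N hN hle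
    set P := (1 + ε) * (R * Real.exp (γ * σ) * (N + S) / η + c0 * S / ω + S) with hP
    have hP0 : 0 ≤ P := by positivity
    filter_upwards [hf] with t h1 ht
    obtain ⟨⟨hg0, hgσ⟩, ⟨hh0, hhτ⟩, hbl, hbB, haA, haR, hder⟩ := h1 ht.1
    have hD : |Dfun x ψ s (g t)| ≤ Real.exp (γ * σ) * (N + S) * Real.exp (-γ * (t - s)) :=
      aux_delay hγ.le hN hS hgσ (fun hs => by
        rw [hDs _ hs]; exact hle _ ⟨hs, by linarith [ht.2]⟩) (hDl _)
    have hXh : |x (h t)| ≤ Real.exp (γ * τ) * (P + S) * Real.exp (-γ * (t - s)) :=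
      aux_delay hγ.le hP0 hS hhτ (fun hs => hXN _ ⟨hs, by linarith [ht.2]⟩)
        (fun hs => hxl _ hs.le)
    have h6 : |a t * Dfun x ψ s (g t)| ≤ 
        A0 * (Real.exp (γ * σ) * (N + S) * Real.exp (-γ * (t - s))) := by
      rw [abs_mul]; exact mul_le_mul haA hD (abs_nonneg _) hA0
    have h7 : |b t * x (h t)| ≤ B * (Real.exp (γ * τ) * (P + S) * Real.exp (-γ * (t - s))) := by
      rw [abs_mul, abs_of_nonneg (by linarith : 0 ≤ b t)]
      exact mul_le_mul hbB hXh (abs_nonneg _) hB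
    rw [hder]
    refine (abs_sub _ _).trans ((add_le_add h6 h7).trans (le_of_eq ?_))
    rw [hP, hθdef, hd0]
    ring)
  have hlast := hX (N0 * S) (by positivity) (fun t ht => by
    refine (hfin t ht).trans (le_of_eq ?_)
    rw [hN0]; ring) t ⟨hst, by linarith⟩
  refine hlast.trans (le_of_eq ?_)
  ring
end

section
/- Let t0 ≥ 0, σ > 0, τ > 0, and let a, b, g, h : ℝ → ℝ be Lebesgue measurable with 0 ≤ t − g(t) ≤ σ and 0 ≤ t − h(t) ≤ τ for almost every t ≥ t0. Define b1(t) := min{ b(t), 1/(τ·e) }. Suppose there exist constants b0 > 0, B ≥ 0, A0 ∈ [0,1), R1 ≥ 0 and R2 ≥ 0 such that for almost every t ≥ t0: b0 ≤ b(t) ≤ B, |a(t)| ≤ A0, |a(t)|/b1(t) ≤ R1 and |b(t) − b1(t)|/b1(t) ≤ R2, and that R1·B/(1 − A0) + R2 < 1. Then the neutral equation x'(t) − a(t)x'(g(t)) = −b(t)·x(h(t)) is uniformly exponentially stable for initial times in [t0,∞). -/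
open MeasureTheory Real

lemma aux_mono_s8 (f : ℝ → ℝ) (p q : ℝ) (hpq : p ≤ q)
    (hd : ∀ t ∈ Set.Icc p q, DifferentiableAt ℝ f t)
    (hb : ∃ C : ℝ, ∀ t ∈ Set.Icc p q, |deriv f t| ≤ C)
    (hn : ∀ᵐ t : ℝ ∂volume, t ∈ Set.Icc p q → 0 ≤ deriv f t) : f p ≤ f q := by
  obtain ⟨C, hC⟩ := hb
  have hint : IntervalIntegrable (deriv f) volume p q := by
    rw [intervalIntegrable_iff_integrableOn_Icc_of_le hpq]
    refine Measure.integrableOn_of_bounded (M := C) (by simp) (measurable_deriv f).aestronglyMeasurable ?_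
    rw [ae_restrict_iff' measurableSet_Icc]
    exact Filter.Eventually.of_forall (fun t ht => by simpa using hC t ht)
  have h1 : ∫ t in p..q, deriv f t = f q - f p := by
    apply intervalIntegral.integral_eq_sub_of_hasDerivAt _ hint
    intro t ht
    rw [Set.uIcc_of_le hpq] at ht
    exact (hd t ht).hasDerivAt
  have h2 : 0 ≤ ∫ t in p..q, deriv f t := by
    apply intervalIntegral.integral_nonneg_of_ae_restrict hpq
    rw [Filter.EventuallyLE, ae_restrict_iff' measurableSet_Icc]
    exact hn
  linarith

lemma aux_pos_s8 (τ s T : ℝ) (hτ : 0 < τ) (z β k : ℝ → ℝ)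
    (hz0 : 0 ≤ z s)
    (hd : ∀ t ∈ Set.Icc s T, DifferentiableAt ℝ z t)
    (hb : ∃ C : ℝ, ∀ t ∈ Set.Icc s T, |deriv z t| ≤ C)
    (hn : ∀ᵐ t : ℝ ∂volume, t ∈ Set.Icc s T →
      (0 ≤ β t ∧ β t ≤ 1 / (τ * Real.exp 1)) ∧ (s ≤ k t ∧ k t ≤ t ∧ t - k t ≤ τ) ∧
      0 ≤ deriv z t + β t * z (k t)) :
    ∀ t ∈ Set.Icc s T, 0 ≤ z t := by
  intro t1 ht1
  have hcont : ContinuousOn (fun u => Real.exp (u / τ) * z u) (Set.Icc s t1) := by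
    apply ContinuousOn.mul
    · fun_prop
    · intro u hu
      exact (hd u ⟨hu.1, hu.2.trans ht1.2⟩).continuousAt.continuousWithinAt
  obtain ⟨r, hr, hmax⟩ := isCompact_Icc.exists_isMaxOn ⟨s, ⟨le_rfl, ht1.1⟩⟩ hcont
  set m := Real.exp (r / τ) * z r with hm
  have hmax' : ∀ u ∈ Set.Icc s t1, Real.exp (u / τ) * z u ≤ m := fun u hu => hmax hu
  have hm0 : 0 ≤ m := le_trans (by positivity) (hmax' s ⟨le_rfl, ht1.1⟩)
  have hE : ∀ t : ℝ, HasDerivAt (fun u => m * Real.exp (-(u / τ))) (-(m / τ) * Real.exp (-(t/τ))) t := by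
    intro t
    have h1 : HasDerivAt (fun u : ℝ => -(u / τ)) (-(1 / τ)) t := ((hasDerivAt_id t).div_const τ).neg
    refine (h1.exp.const_mul m).congr_deriv ?_
    ring
  have hD : ∀ t ∈ Set.Icc s T, HasDerivAt (fun u => z u - m * Real.exp (-(u / τ)))
      (deriv z t - (-(m / τ) * Real.exp (-(t/τ)))) t := fun t ht =>
    (hd t ht).hasDerivAt.sub (hE t)
  have hsub : ∀ t ∈ Set.Icc r t1, t ∈ Set.Icc s T := fun t ht =>
    ⟨hr.1.trans ht.1, ht.2.trans ht1.2⟩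
  have key := aux_mono_s8 (fun u => z u - m * Real.exp (-(u / τ))) r t1 hr.2
    (fun t ht => (hD t (hsub t ht)).differentiableAt) ?_ ?_
  · have : m * Real.exp (-(r / τ)) = z r := by
      rw [hm, mul_right_comm, ← Real.exp_add]; simp
    have h2 : 0 ≤ m * Real.exp (-(t1 / τ)) := by positivity
    linarith
  · obtain ⟨C, hC⟩ := hb
    refine ⟨C + |m / τ| * Real.exp (-(r / τ)), fun t ht => ?_⟩
    rw [(hD t (hsub t ht)).deriv]
    refine (abs_sub _ _).trans ?_
    rw [abs_mul, abs_neg, Real.abs_exp]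
    have : Real.exp (-(t / τ)) ≤ Real.exp (-(r / τ)) := by
      apply Real.exp_le_exp.2
      have := div_le_div_of_nonneg_right ht.1 hτ.le
      linarith
    have := hC t (hsub t ht)
    gcongr
  · filter_upwards [hn] with t hnt ht
    obtain ⟨⟨hb0, hb1⟩, ⟨hk0, hk1, hk2⟩, hder⟩ := hnt (hsub t ht)
    rw [(hD t (hsub t ht)).deriv]
    have h1 : z (k t) ≤ m * Real.exp (-(k t / τ)) := by
      have := hmax' (k t) ⟨hk0, hk1.trans ht.2⟩
      rw [Real.exp_neg, ← div_eq_mul_inv, le_div_iff₀ (Real.exp_pos _)]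
      linarith
    have h2 : Real.exp (-(k t / τ)) ≤ Real.exp 1 * Real.exp (-(t/τ)) := by
      rw [← Real.exp_add]
      apply Real.exp_le_exp.2
      have : (t - k t) / τ ≤ 1 := by rw [div_le_one hτ]; exact hk2
      rw [sub_div] at this
      linarith
    have h3 : β t * z (k t) ≤ (1 / (τ * Real.exp 1)) * (m * (Real.exp 1 * Real.exp (-(t/τ)))) := by
      calc β t * z (k t) ≤ β t * (m * (Real.exp 1 * Real.exp (-(t/τ)))) := by
            apply mul_le_mul_of_nonneg_left _ hb0
            exact h1.trans (mul_le_mul_of_nonneg_left h2 hm0)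
        _ ≤ _ := by
            apply mul_le_mul_of_nonneg_right hb1; positivity
    have h4 : (1 / (τ * Real.exp 1)) * (m * (Real.exp 1 * Real.exp (-(t/τ)))) = m / τ * Real.exp (-(t/τ)) := by
      have := Real.exp_pos 1
      field_simp
    linarith

/-- an a.e. bound on the derivative gives a bound everywhere -/
lemma aux_deriv_le_s8 (x : ℝ → ℝ) (t T c : ℝ) (htT : t < T)
    (hd : ∀ u ∈ Set.Icc t T, DifferentiableAt ℝ x u)
    (hb : ∃ C : ℝ, ∀ u ∈ Set.Icc t T, |deriv x u| ≤ C)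
    (hn : ∀ᵐ u : ℝ ∂volume, u ∈ Set.Icc t T → deriv x u ≤ c) : deriv x t ≤ c := by
  have h1 : ∀ u ∈ Set.Ioo t T, slope x t u ≤ c := by
    intro u hu
    have hsub : ∀ v ∈ Set.Icc t u, v ∈ Set.Icc t T := fun v hv => ⟨hv.1, hv.2.trans hu.2.le⟩
    have hD : ∀ v ∈ Set.Icc t u, HasDerivAt (fun v => c * v - x v) (c - deriv x v) v := by
      intro v hv
      have := ((hasDerivAt_id v).const_mul c).sub (hd v (hsub v hv)).hasDerivAt
      exact this.congr_deriv (by simp)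
    have key := aux_mono_s8 (fun v => c * v - x v) t u hu.1.le
      (fun v hv => (hD v hv).differentiableAt) ?_ ?_
    · rw [slope_def_field, div_le_iff₀ (by linarith [hu.1])]
      linarith
    · obtain ⟨C, hC⟩ := hb
      refine ⟨|c| + C, fun v hv => ?_⟩
      rw [(hD v hv).deriv]
      exact (abs_sub _ _).trans (by linarith [hC v (hsub v hv)])
    · filter_upwards [hn] with v hv hv'
      rw [(hD v hv').deriv]
      linarith [hv (hsub v hv')]
  have h2 := (hasDerivAt_iff_tendsto_slope.1 (hd t ⟨le_rfl, htT.le⟩).hasDerivAt)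
  have h3 : Filter.Tendsto (slope x t) (nhdsWithin t (Set.Ioi t)) (nhds (deriv x t)) :=
    h2.mono_left (nhdsWithin_mono _ (fun u hu => ne_of_gt hu))
  refine le_of_tendsto h3 ?_
  filter_upwards [Ioo_mem_nhdsGT htT] with u hu using h1 u hu

lemma aux_deriv_abs_le (x : ℝ → ℝ) (t T c : ℝ) (htT : t < T)
    (hd : ∀ u ∈ Set.Icc t T, DifferentiableAt ℝ x u)
    (hb : ∃ C : ℝ, ∀ u ∈ Set.Icc t T, |deriv x u| ≤ C)
    (hn : ∀ᵐ u : ℝ ∂volume, u ∈ Set.Icc t T → |deriv x u| ≤ c) : |deriv x t| ≤ c := by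
  rw [abs_le']
  refine ⟨aux_deriv_le_s8 x t T c htT hd hb ?_, ?_⟩
  · filter_upwards [hn] with u hu hu' using (abs_le'.1 (hu hu')).1
  · have := aux_deriv_le_s8 (fun u => -x u) t T c htT (fun u hu => (hd u hu).neg) ?_ ?_
    · simpa [deriv.fun_neg] using this
    · simpa [deriv.fun_neg] using hb
    · filter_upwards [hn] with u hu hu'
      simpa [deriv.fun_neg] using (abs_le'.1 (hu hu')).2

lemma aux_shift (γ s δ P t w : ℝ) (hγ : 0 < γ) (hP : 0 ≤ P) (y : ℝ)
    (hy : |y| ≤ P * Real.exp (-γ * (w - s))) (hw : t - w ≤ δ) :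
    |y| ≤ P * Real.exp (γ * δ) * Real.exp (-γ * (t - s)) := by
  refine hy.trans ?_
  rw [mul_assoc, ← Real.exp_add]
  apply mul_le_mul_of_nonneg_left _ hP
  apply Real.exp_le_exp.2
  nlinarith

lemma aux_Dbound (s T γ σ τ A0 B N P : ℝ) (hsT : s < T) (hγ : 0 < γ) (hA0 : 0 ≤ A0) (hB : 0 ≤ B)
    (hN : 0 ≤ N) (hP : 0 ≤ P) (hA : A0 * Real.exp (γ * σ) < 1)
    (x ψ g h : ℝ → ℝ)
    (hd : ∀ u ∈ Set.Icc s T, DifferentiableAt ℝ x u)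
    (hb : ∃ C : ℝ, ∀ u ∈ Set.Icc s T, |deriv x u| ≤ C)
    (hx : ∀ u ≤ T, |x u| ≤ P * Real.exp (-γ * (u - s)))
    (hψ : ∀ u < s, |ψ u| ≤ N)
    (hn : ∀ᵐ t : ℝ ∂volume, s ≤ t → (g t ≤ t ∧ t - g t ≤ σ) ∧ (h t ≤ t ∧ t - h t ≤ τ) ∧
      |Dfun x ψ s t| ≤ A0 * |Dfun x ψ s (g t)| + B * |x (h t)|) :
    ∀ u < T, |Dfun x ψ s u| ≤
      (N + B * Real.exp (γ * τ) / (1 - A0 * Real.exp (γ * σ)) * P) * Real.exp (-γ * (u - s)) := by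
  set F : ℝ → ℝ := fun u => |deriv x u| * Real.exp (γ * (u - s)) with hF
  have hEE : ∀ u, Real.exp (γ * (u - s)) * Real.exp (-γ * (u - s)) = 1 := by
    intro u; rw [← Real.exp_add]; simp
  obtain ⟨C, hC⟩ := hb
  have hbdd : BddAbove (F '' Set.Ico s T) := by
    refine ⟨C * Real.exp (γ * (T - s)), ?_⟩
    rintro _ ⟨u, hu, rfl⟩
    have h1 := hC u ⟨hu.1, hu.2.le⟩
    have h2 : Real.exp (γ * (u - s)) ≤ Real.exp (γ * (T - s)) := by
      apply Real.exp_le_exp.2; nlinarith [hu.2]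
    exact mul_le_mul h1 h2 (Real.exp_pos _).le ((abs_nonneg _).trans h1)
  have hne : (F '' Set.Ico s T).Nonempty := ⟨F s, s, ⟨le_rfl, hsT⟩, rfl⟩
  set S := sSup (F '' Set.Ico s T) with hS
  set Q := max S N with hQ
  have hQ0 : 0 ≤ Q := hN.trans (le_max_right _ _)
  have hDQ : ∀ u < T, |Dfun x ψ s u| ≤ Q * Real.exp (-γ * (u - s)) := by
    intro u hu
    by_cases hsu : s ≤ u
    · simp only [Dfun, hsu, if_true]
      have h1 : F u ≤ Q := (le_csSup hbdd ⟨u, ⟨hsu, hu⟩, rfl⟩).trans (le_max_left _ _)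
      calc |deriv x u| = F u * Real.exp (-γ * (u - s)) := by
            simp only [hF]; rw [mul_assoc, hEE, mul_one]
        _ ≤ _ := mul_le_mul_of_nonneg_right h1 (Real.exp_pos _).le
    · simp only [Dfun, hsu, if_false]
      have h1 : 1 ≤ Real.exp (-γ * (u - s)) := Real.one_le_exp (by nlinarith)
      calc |ψ u| ≤ Q * 1 := by rw [mul_one]; exact (hψ u (not_le.1 hsu)).trans (le_max_right _ _)
        _ ≤ _ := mul_le_mul_of_nonneg_left h1 hQ0
  set c := A0 * (Q * Real.exp (γ * σ)) + B * (P * Real.exp (γ * τ)) with hc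
  have hc0 : 0 ≤ c := by positivity
  have hae : ∀ᵐ t : ℝ ∂volume, t ∈ Set.Ico s T → |deriv x t| ≤ c * Real.exp (-γ * (t - s)) := by
    filter_upwards [hn] with t ht htm
    obtain ⟨⟨hg1, hg2⟩, ⟨hh1, hh2⟩, h3⟩ := ht htm.1
    have h4 := aux_shift γ s σ Q t (g t) hγ hQ0 _ (hDQ (g t) (hg1.trans_lt htm.2)) hg2
    have h5 := aux_shift γ s τ P t (h t) hγ hP _ (hx (h t) (hh1.trans htm.2.le)) hh2
    have h6 : Dfun x ψ s t = deriv x t := by simp [Dfun, htm.1]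
    rw [h6] at h3
    have h7 := mul_le_mul_of_nonneg_left h4 hA0
    have h8 := mul_le_mul_of_nonneg_left h5 hB
    rw [hc]
    linarith
  have hev : ∀ t ∈ Set.Ico s T, |deriv x t| ≤ c * Real.exp (-γ * (t - s)) := by
    intro t ht
    have hsub : ∀ u ∈ Set.Icc t ((t+T)/2), u ∈ Set.Ico s T := fun u hu =>
      ⟨ht.1.trans hu.1, by linarith [hu.2, ht.2]⟩
    refine aux_deriv_abs_le x t ((t + T) / 2) _ (by linarith [ht.2])
      (fun u hu => hd u ⟨(hsub u hu).1, (hsub u hu).2.le⟩)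
      ⟨C, fun u hu => hC u ⟨(hsub u hu).1, (hsub u hu).2.le⟩⟩ ?_
    filter_upwards [hae] with u hu hum
    refine (hu (hsub u hum)).trans (mul_le_mul_of_nonneg_left ?_ hc0)
    apply Real.exp_le_exp.2
    nlinarith [hum.1]
  have hSc : S ≤ c := by
    apply csSup_le hne
    rintro _ ⟨u, hu, rfl⟩
    calc F u ≤ c * Real.exp (-γ * (u - s)) * Real.exp (γ * (u - s)) :=
          mul_le_mul_of_nonneg_right (hev u hu) (Real.exp_pos _).le
      _ = c := by rw [mul_assoc, mul_comm (Real.exp _), hEE, mul_one]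
  have hden : 0 < 1 - A0 * Real.exp (γ * σ) := by linarith
  have hQle : Q ≤ N + B * Real.exp (γ * τ) / (1 - A0 * Real.exp (γ * σ)) * P := by
    have hnn : 0 ≤ B * Real.exp (γ * τ) / (1 - A0 * Real.exp (γ * σ)) * P := by positivity
    rcases le_total S N with h1 | h1
    · have : Q = N := max_eq_right h1
      linarith
    · have hQS : Q = S := max_eq_left h1
      have h2 : S ≤ B * Real.exp (γ * τ) / (1 - A0 * Real.exp (γ * σ)) * P := by
        rw [div_mul_eq_mul_div, le_div_iff₀ hden]
        rw [hc, hQS] at hSc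
        linarith
      linarith
  intro u hu
  exact (hDQ u hu).trans (mul_le_mul_of_nonneg_right hQle (Real.exp_pos _).le)

lemma aux_upper_s8 (s T γ τ N P K L : ℝ) (hsT : s < T) (hγ : 0 < γ) (hτ : 0 < τ)
    (hN : 0 ≤ N) (hK : 0 ≤ K) (hL : 0 ≤ L)
    (x h β f : ℝ → ℝ) (b0 : ℝ) (hb0 : 0 < b0)
    (hd : ∀ u ∈ Set.Icc s T, DifferentiableAt ℝ x u)
    (hb : ∃ C : ℝ, ∀ u ∈ Set.Icc s T, |deriv x u| ≤ C)
    (hx : ∀ u ≤ s, |x u| ≤ N) (hNK : N ≤ K)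
    (hKL : L + 2 * N * Real.exp (γ * τ) ≤ K * (1 - γ / b0))
    (hn : ∀ᵐ t : ℝ ∂volume, t ∈ Set.Icc s T → (b0 ≤ β t ∧ β t ≤ 1 / (τ * Real.exp 1)) ∧
      (h t ≤ t ∧ t - h t ≤ τ) ∧ deriv x t = - (β t * x (h t)) + f t ∧
      f t ≤ β t * (L * Real.exp (-γ * (t - s)))) :
    ∀ t ∈ Set.Icc s T, x t ≤ K * Real.exp (-γ * (t - s)) := by
  have hE : ∀ t : ℝ, HasDerivAt (fun u => K * Real.exp (-γ * (u - s)))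
      (-γ * (K * Real.exp (-γ * (t - s)))) t := by
    intro t
    have h1 : HasDerivAt (fun u : ℝ => -γ * (u - s)) (-γ * 1) t :=
      ((hasDerivAt_id t).sub_const s).const_mul (-γ)
    refine (h1.exp.const_mul K).congr_deriv ?_
    ring
  have hD : ∀ t ∈ Set.Icc s T, HasDerivAt (fun u => K * Real.exp (-γ * (u - s)) - x u)
      (-γ * (K * Real.exp (-γ * (t - s))) - deriv x t) t := fun t ht =>
    (hE t).sub (hd t ht).hasDerivAt
  have key := aux_pos_s8 τ s T hτ (fun u => K * Real.exp (-γ * (u - s)) - x u) β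
    (fun t => max (h t) s) ?_ (fun t ht => (hD t ht).differentiableAt) ?_ ?_
  · intro t ht
    have := key t ht
    linarith
  · have := (abs_le'.1 (hx s le_rfl)).1
    simp
    linarith
  · obtain ⟨C, hC⟩ := hb
    refine ⟨γ * K + C, fun t ht => ?_⟩
    rw [(hD t ht).deriv]
    refine (abs_sub _ _).trans (add_le_add ?_ (hC t ht))
    rw [abs_mul, abs_neg, abs_of_pos hγ, abs_mul, abs_of_nonneg hK, Real.abs_exp]
    have : Real.exp (-γ * (t - s)) ≤ 1 := Real.exp_le_one_iff.2 (by nlinarith [ht.1])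
    have : K * Real.exp (-γ * (t - s)) ≤ K := mul_le_of_le_one_right hK this
    exact mul_le_mul_of_nonneg_left this hγ.le
  · filter_upwards [hn] with t hnt ht
    obtain ⟨⟨hb1, hb2⟩, ⟨hh1, hh2⟩, hde, hf⟩ := hnt ht
    have hβ : 0 < β t := hb0.trans_le hb1
    refine ⟨⟨hβ.le, hb2⟩, ⟨le_max_right _ _, max_le hh1 ht.1, ?_⟩, ?_⟩
    · linarith [le_max_left (h t) s]
    rw [(hD t ht).deriv, hde]
    set e := Real.exp (-γ * (t - s)) with he
    have he0 : 0 < e := Real.exp_pos _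
    have h1 : e ≤ Real.exp (-γ * (max (h t) s - s)) := by
      apply Real.exp_le_exp.2
      have : max (h t) s ≤ t := max_le hh1 ht.1
      nlinarith
    have h1' := mul_le_mul_of_nonneg_left h1 hK
    have h2 : x (max (h t) s) - x (h t) ≤ 2 * N * Real.exp (γ * τ) * e := by
      rcases le_total s (h t) with h3 | h3
      · rw [max_eq_left h3, sub_self]; positivity
      · rw [max_eq_right h3]
        have h4 := (abs_le'.1 (hx s le_rfl)).1
        have h5 := (abs_le'.1 (hx (h t) h3)).2
        have h6 : 1 ≤ Real.exp (γ * τ) * e := by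
          rw [he, ← Real.exp_add]; apply Real.one_le_exp; nlinarith
        have : 2 * N * 1 ≤ 2 * N * (Real.exp (γ * τ) * e) :=
          mul_le_mul_of_nonneg_left h6 (by positivity)
        linarith
    have h3 : γ ≤ β t * (γ / b0) := by
      have : b0 * (γ / b0) ≤ β t * (γ / b0) := mul_le_mul_of_nonneg_right hb1 (by positivity)
      rwa [mul_div_cancel₀ _ hb0.ne'] at this
    have h4 : γ * (K * e) ≤ β t * (γ / b0) * (K * e) := mul_le_mul_of_nonneg_right h3 (by positivity)
    have h5 := mul_le_mul_of_nonneg_right hKL (mul_nonneg hβ.le he0.le)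
    have h6 := mul_le_mul_of_nonneg_left h2 hβ.le
    have h7 := mul_le_mul_of_nonneg_left h1' hβ.le
    nlinarith

lemma aux_gamma_s8 (σ τ b1 B A0 R1 R2 : ℝ) (hb1 : 0 < b1) (hA0' : A0 < 1)
    (hcond : R1 * B / (1 - A0) + R2 < 1) :
    ∃ γ > (0:ℝ), A0 * Real.exp (γ * σ) < 1 ∧
      R1 * Real.exp (γ * σ) * (B * Real.exp (γ * τ) / (1 - A0 * Real.exp (γ * σ)))
        + R2 * Real.exp (γ * τ) < 1 - γ / b1 := by
  have h1 : ∀ᶠ γ : ℝ in nhds 0, A0 * Real.exp (γ * σ) < 1 := by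
    have hc : ContinuousAt (fun γ : ℝ => A0 * Real.exp (γ * σ)) 0 := by fun_prop
    exact hc.eventually_lt continuousAt_const (by simpa using hA0')
  have h2 : ∀ᶠ γ : ℝ in nhds 0,
      R1 * Real.exp (γ * σ) * (B * Real.exp (γ * τ) / (1 - A0 * Real.exp (γ * σ)))
        + R2 * Real.exp (γ * τ) < 1 - γ / b1 := by
    have hne : 1 - A0 * Real.exp (0 * σ) ≠ 0 := by simp; linarith
    have hc : ContinuousAt (fun γ : ℝ =>
        R1 * Real.exp (γ * σ) * (B * Real.exp (γ * τ) / (1 - A0 * Real.exp (γ * σ)))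
        + R2 * Real.exp (γ * τ)) 0 := by
      apply ContinuousAt.add _ (by fun_prop)
      apply ContinuousAt.mul (by fun_prop)
      exact ContinuousAt.div (by fun_prop) (by fun_prop) hne
    have hc2 : ContinuousAt (fun γ : ℝ => 1 - γ / b1) 0 := by fun_prop
    refine hc.eventually_lt hc2 ?_
    simpa [mul_div_assoc] using hcond
  have h3 : ∀ᶠ γ : ℝ in nhdsWithin 0 (Set.Ioi 0), 0 < γ := self_mem_nhdsWithin
  obtain ⟨γ, hγ⟩ := (h3.and ((h1.and h2).filter_mono nhdsWithin_le_nhds)).exists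
  exact ⟨γ, hγ.1, hγ.2.1, hγ.2.2⟩

/-- Condition (5.2) of Proposition 5.1, where `b1(t) = min {b(t), 1/(τe)}`. -/
theorem proposition5_1_condition2
    (t0 : ℝ) (ht0 : 0 ≤ t0) (σ τ : ℝ) (hσ : 0 < σ) (hτ : 0 < τ)
    (a b g h : ℝ → ℝ)
    (ham : Measurable a) (hbm : Measurable b) (hgm : Measurable g) (hhm : Measurable h)
    (hgdel : ∀ᵐ t : ℝ ∂volume, t0 ≤ t → 0 ≤ t - g t ∧ t - g t ≤ σ)
    (hhdel : ∀ᵐ t : ℝ ∂volume, t0 ≤ t → 0 ≤ t - h t ∧ t - h t ≤ τ)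
    (b0 B A0 R1 R2 : ℝ) (hb0 : 0 < b0) (hB : 0 ≤ B) (hA0 : 0 ≤ A0) (hA0' : A0 < 1)
    (hR1 : 0 ≤ R1) (hR2 : 0 ≤ R2)
    (hae : ∀ᵐ t : ℝ ∂volume, t0 ≤ t →
      b0 ≤ b t ∧ b t ≤ B ∧ |a t| ≤ A0 ∧
      |a t| / min (b t) (1 / (τ * Real.exp 1)) ≤ R1 ∧
      |b t - min (b t) (1 / (τ * Real.exp 1))| / min (b t) (1 / (τ * Real.exp 1)) ≤ R2)
    (hcond : R1 * B / (1 - A0) + R2 < 1) :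
    UnifExpStable1 a b g h t0 := by
  have hte : 0 < 1 / (τ * Real.exp 1) := by positivity
  set b1 := min b0 (1 / (τ * Real.exp 1)) with hb1d
  have hb1 : 0 < b1 := lt_min hb0 hte
  obtain ⟨γ, hγ, hA, hρ⟩ := aux_gamma_s8 σ τ b1 B A0 R1 R2 hb1 hA0' hcond
  set μ := B * Real.exp (γ * τ) / (1 - A0 * Real.exp (γ * σ)) with hμd
  set ρ := R1 * Real.exp (γ * σ) * μ + R2 * Real.exp (γ * τ) with hρd
  set κ := 1 - γ / b1 with hκd
  set C := R1 * Real.exp (γ * σ) + 2 * Real.exp (γ * τ) with hCd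
  have hden : 0 < 1 - A0 * Real.exp (γ * σ) := by linarith
  have hμ : 0 ≤ μ := by positivity
  have hρ0 : 0 ≤ ρ := by positivity
  have hκ1 : κ ≤ 1 := by
    have : 0 ≤ γ / b1 := by positivity
    linarith
  have hκ0 : 0 < κ := by linarith
  have hC1 : 1 ≤ C := by
    have h1 : 1 ≤ Real.exp (γ * τ) := Real.one_le_exp (by positivity)
    have h2 : 0 ≤ R1 * Real.exp (γ * σ) := by positivity
    linarith
  have hM1 : 1 ≤ C / (κ - ρ) := by
    rw [le_div_iff₀ (by linarith)]; linarith
  refine ⟨C / (κ - ρ), by linarith, γ, hγ, ?_⟩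
  intro s hs φ ψ x hφ hψ ⟨hx1, hx2, hx3, hx4⟩ T hsT0
  set N := ⨆ u : {u : ℝ // u ≤ s}, (|φ u.1| + |ψ u.1|) with hNd
  have hNu : ∀ u ≤ s, |φ u| + |ψ u| ≤ N := by
    intro u hu
    obtain ⟨c1, hc1⟩ := hφ
    obtain ⟨c2, hc2⟩ := hψ
    have hbd : BddAbove (Set.range (fun u : {u : ℝ // u ≤ s} => |φ u.1| + |ψ u.1|)) := by
      refine ⟨c1 + c2, ?_⟩
      rintro _ ⟨v, rfl⟩
      exact add_le_add (hc1 _) (hc2 _)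
    exact le_ciSup hbd ⟨u, hu⟩
  have hxN : ∀ u ≤ s, |x u| ≤ N := by
    intro u hu
    rw [hx1 u hu]
    linarith [hNu u hu, abs_nonneg (ψ u)]
  have hψN : ∀ u ≤ s, |ψ u| ≤ N := by
    intro u hu
    linarith [hNu u hu, abs_nonneg (φ u)]
  have hN : 0 ≤ N := (abs_nonneg _).trans (hxN s le_rfl)
  rcases hsT0.eq_or_lt with rfl | hsT
  · have := hxN s le_rfl
    simp only [sub_self, mul_zero, Real.exp_zero, mul_one]
    nlinarith
  have hEE : ∀ u, Real.exp (γ * (u - s)) * Real.exp (-γ * (u - s)) = 1 := by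
    intro u; rw [← Real.exp_add]; simp
  have hd : ∀ u ∈ Set.Icc s T, DifferentiableAt ℝ x u := fun u hu => hx2 u hu.1
  have hcont : ContinuousOn (fun u => |x u| * Real.exp (γ * (u - s))) (Set.Icc s T) := by
    apply ContinuousOn.mul
    · intro u hu
      exact (hd u hu).continuousAt.abs.continuousWithinAt
    · fun_prop
  obtain ⟨r, hr, hmax⟩ := isCompact_Icc.exists_isMaxOn ⟨s, ⟨le_rfl, hsT0⟩⟩ hcont
  set S := |x r| * Real.exp (γ * (r - s)) with hSd
  have hmax' : ∀ u ∈ Set.Icc s T, |x u| ≤ S * Real.exp (-γ * (u - s)) := by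
    intro u hu
    have h1 : |x u| * Real.exp (γ * (u - s)) ≤ S := hmax hu
    calc |x u| = |x u| * Real.exp (γ * (u - s)) * Real.exp (-γ * (u - s)) := by
          rw [mul_assoc, hEE, mul_one]
      _ ≤ _ := mul_le_mul_of_nonneg_right h1 (Real.exp_pos _).le
  set P := max S N with hPd
  have hP : 0 ≤ P := hN.trans (le_max_right _ _)
  have hxP : ∀ u ≤ T, |x u| ≤ P * Real.exp (-γ * (u - s)) := by
    intro u hu
    rcases le_total s u with h1 | h1
    · exact (hmax' u ⟨h1, hu⟩).trans
        (mul_le_mul_of_nonneg_right (le_max_left _ _) (Real.exp_pos _).le)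
    · have h2 : 1 ≤ Real.exp (-γ * (u - s)) := Real.one_le_exp (by nlinarith)
      calc |x u| ≤ P * 1 := by rw [mul_one]; exact (hxN u h1).trans (le_max_right _ _)
        _ ≤ _ := mul_le_mul_of_nonneg_left h2 hP
  have hDb := aux_Dbound s T γ σ τ A0 B N P hsT hγ hA0 hB hN hP hA x ψ g h hd (hx3 T hsT0) hxP
    (fun u hu => hψN u hu.le) (by
      filter_upwards [hgdel, hhdel, hae, hx4] with t h1 h2 h3 h4 hst
      have ht0t := hs.trans hst
      obtain ⟨g1, g2⟩ := h1 ht0t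
      obtain ⟨k1, k2⟩ := h2 ht0t
      obtain ⟨e1, e2, e3, -, -⟩ := h3 ht0t
      refine ⟨⟨by linarith, g2⟩, ⟨by linarith, k2⟩, ?_⟩
      have h5 : Dfun x ψ s t = a t * Dfun x ψ s (g t) - b t * x (h t) := by linarith [h4 hst]
      rw [h5]
      refine (abs_sub _ _).trans ?_
      rw [abs_mul, abs_mul, abs_of_pos (hb0.trans_le e1)]
      exact add_le_add (mul_le_mul_of_nonneg_right e3 (abs_nonneg _))
        (mul_le_mul_of_nonneg_right e2 (abs_nonneg _)))
  rw [← hμd] at hDb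
  set L := ρ * P + R1 * Real.exp (γ * σ) * N with hLd
  have hL : 0 ≤ L := by positivity
  set K := (ρ * P + C * N) / κ with hKd
  have hKκ : K * κ = ρ * P + C * N := div_mul_cancel₀ _ hκ0.ne'
  have hK : 0 ≤ K := by positivity
  have hNK : N ≤ K := by
    rw [hKd, le_div_iff₀ hκ0]
    have h1 : N * κ ≤ N * 1 := mul_le_mul_of_nonneg_left hκ1 hN
    have h2 : 1 * N ≤ C * N := mul_le_mul_of_nonneg_right hC1 hN
    have h3 : 0 ≤ ρ * P := by positivity
    linarith
  have hKL : L + 2 * N * Real.exp (γ * τ) ≤ K * (1 - γ / b1) := by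
    rw [← hκd, hKκ, hLd, hCd]
    linarith
  set β : ℝ → ℝ := fun t => min (b t) (1 / (τ * Real.exp 1)) with hβd
  have hmain : ∀ᵐ t : ℝ ∂volume, t ∈ Set.Icc s T → (b1 ≤ β t ∧ β t ≤ 1 / (τ * Real.exp 1)) ∧
      (h t ≤ t ∧ t - h t ≤ τ) ∧
      |deriv x t + β t * x (h t)| ≤ β t * (L * Real.exp (-γ * (t - s))) := by
    have hneT : ∀ᵐ t : ℝ ∂volume, t ≠ T := by
      simp [ae_iff]
    filter_upwards [hgdel, hhdel, hae, hx4, hneT] with t h1 h2 h3 h4 h6 htm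
    have hst := htm.1
    have ht0t := hs.trans hst
    obtain ⟨g1, g2⟩ := h1 ht0t
    obtain ⟨k1, k2⟩ := h2 ht0t
    obtain ⟨e1, e2, e3, e4, e5⟩ := h3 ht0t
    have hββ : b1 ≤ β t := min_le_min_right _ e1
    have hβ : 0 < β t := hb1.trans_le hββ
    refine ⟨⟨hββ, min_le_right _ _⟩, ⟨by linarith, k2⟩, ?_⟩
    have htT : t < T := lt_of_le_of_ne htm.2 h6
    rw [div_le_iff₀ hβ] at e4 e5
    have h7 : Dfun x ψ s t = deriv x t := by simp [Dfun, hst]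
    have h8 : deriv x t + β t * x (h t) = a t * Dfun x ψ s (g t) - (b t - β t) * x (h t) := by
      rw [← h7]; linarith [h4 hst]
    rw [h8]
    refine (abs_sub _ _).trans ?_
    rw [abs_mul, abs_mul]
    have q1 := aux_shift γ s σ (N + μ * P) t (g t) hγ (by positivity) _
      (hDb (g t) (by linarith)) g2
    have q2 := aux_shift γ s τ P t (h t) hγ hP _ (hxP (h t) (by linarith)) k2
    have q3 := mul_le_mul e4 q1 (abs_nonneg _) (by positivity)
    have q4 := mul_le_mul e5 q2 (abs_nonneg _) (by positivity)
    refine (add_le_add q3 q4).trans (le_of_eq ?_)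
    rw [hLd, hρd]
    ring
  have hup := aux_upper_s8 s T γ τ N P K L hsT hγ hτ hN hK hL x h β
    (fun t => deriv x t + β t * x (h t)) b1 hb1 hd (hx3 T hsT0) hxN hNK hKL (by
      filter_upwards [hmain] with t ht htm
      obtain ⟨h1, h2, h3⟩ := ht htm
      exact ⟨h1, h2, by ring, (abs_le'.1 h3).1⟩)
  have hlo := aux_upper_s8 s T γ τ N P K L hsT hγ hτ hN hK hL (fun u => -x u) h β
    (fun t => -(deriv x t + β t * x (h t))) b1 hb1 (fun u hu => (hd u hu).neg)
    (by simpa [deriv.fun_neg] using hx3 T hsT0) (by simpa using hxN) hNK hKL (by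
      filter_upwards [hmain] with t ht htm
      obtain ⟨h1, h2, h3⟩ := ht htm
      exact ⟨h1, h2, by rw [deriv.fun_neg]; ring, (abs_le'.1 h3).2⟩)
  have hSK : S ≤ K := by
    have h1 : |x r| ≤ K * Real.exp (-γ * (r - s)) := abs_le'.2 ⟨hup r hr, hlo r hr⟩
    calc S ≤ K * Real.exp (-γ * (r - s)) * Real.exp (γ * (r - s)) :=
          mul_le_mul_of_nonneg_right h1 (Real.exp_pos _).le
      _ = K := by rw [mul_assoc, mul_comm (Real.exp _), hEE, mul_one]
  have hSM : S ≤ C / (κ - ρ) * N := by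
    rcases le_total S N with h1 | h1
    · exact h1.trans (le_mul_of_one_le_left hN hM1)
    · have hPS : P = S := max_eq_left h1
      rw [div_mul_eq_mul_div, le_div_iff₀ (by linarith)]
      have h2 := mul_le_mul_of_nonneg_right hSK hκ0.le
      rw [hKκ, hPS] at h2
      linarith
  calc |x T| ≤ S * Real.exp (-γ * (T - s)) := hmax' T ⟨hsT0, le_rfl⟩
    _ ≤ C / (κ - ρ) * N * Real.exp (-γ * (T - s)) :=
        mul_le_mul_of_nonneg_right hSM (Real.exp_pos _).le
    _ = _ := by ring
end
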